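/- arXiv:2506.22144 — 5 statements merged into one kernel-verified Lean document; each statement's English description precedes it below -/
import Mathlib

section
/- Let V = (Loc, ℓ_0, X, Δ) be a VASS in which every transition changes exactly one counter by exactly ±1, let ℓ_f ∈ Loc, and let P'_V be the Wait-Only protocol built from V for the coverability reduction (with the reception of start from locations of V leading to err, and with q_f an action state). Then ℓ_f is coverable in V, i.e., (ℓ_0, 0) ⇝* (ℓ_f, v) for some v ∈ N^X, if and only if there exist an initial configuration C_0 of P'_V and a configuration C_f such that C_0 →* C_f and C_f(e) = q_f for all e ∈ [1, ||C_f||]. -/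
set_option maxHeartbeats 1000000

inductive Act (M : Type) where
  | send : M → Act M
  | recv : M → Act M

structure Protocol (Q M : Type) where
  qin : Q
  T : Set (Q × Act M × Q)

namespace Protocol

variable {Q M : Type}

/-- Messages receivable from state `q`. -/
def R (P : Protocol Q M) (q : Q) : Set M := {a | ∃ q', (q, Act.recv a, q') ∈ P.T}

/-- `q` has an outgoing reception transition. -/
def isWaiting (P : Protocol Q M) (q : Q) : Prop := ∃ a q', (q, Act.recv a, q') ∈ P.T

/-- The set of waiting states. -/
def QW (P : Protocol Q M) : Set Q := {q | P.isWaiting q}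

/-- The set of action states. -/
def QA (P : Protocol Q M) : Set Q := {q | ¬ P.isWaiting q}

/-- Wait-Only protocol: every state has no receptions or no broadcasts; the initial
state is an action state; there is no broadcast self-loop. -/
def WaitOnly (P : Protocol Q M) : Prop :=
  (∀ q : Q, ¬ P.isWaiting q ∨ ¬ ∃ a q', (q, Act.send a, q') ∈ P.T) ∧
  ¬ P.isWaiting P.qin ∧
  ∀ q a, (q, Act.send a, q) ∉ P.T

/-- `qu` is an uncoverable state. -/
def Uncoverable (P : Protocol Q M) (qu : Q) : Prop :=
  (∀ q α q', (q, α, q') ∈ P.T → q ≠ qu ∧ q' ≠ qu) ∧ qu ≠ P.qin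

/-- One broadcast step, performed by process `e` via transition `t`. -/
def Step (P : Protocol Q M) {n : ℕ} (e : Fin n) (t : Q × Act M × Q) (C C' : Fin n → Q) : Prop :=
  ∃ q a q', t = (q, Act.send a, q') ∧ t ∈ P.T ∧ C e = q ∧ C' e = q' ∧
    ∀ e' : Fin n, e' ≠ e →
      ((C e', Act.recv a, C' e') ∈ P.T ∨ (a ∉ P.R (C e') ∧ C' e' = C e'))

def StepAny (P : Protocol Q M) {n : ℕ} (C C' : Fin n → Q) : Prop :=
  ∃ e t, P.Step e t C C'

def Reach (P : Protocol Q M) {n : ℕ} : (Fin n → Q) → (Fin n → Q) → Prop :=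
  Relation.ReflTransGen P.StepAny

def Initial (P : Protocol Q M) {n : ℕ} (C : Fin n → Q) : Prop := ∀ e, C e = P.qin

end Protocol

/-- A finite or infinite execution: `len` is the number of configurations (`⊤` = infinite);
configurations beyond the length are irrelevant. -/
structure Exec {Q M : Type} (P : Protocol Q M) (n : ℕ) where
  npos : 0 < n
  len : ℕ∞
  len_pos : 1 ≤ len
  conf : ℕ → Fin n → Q
  init : P.Initial (conf 0)
  step : ∀ i : ℕ, ((i : ℕ∞) + 1) < len → P.StepAny (conf i) (conf (i + 1))

namespace Exec

variable {Q M : Type} {P : Protocol Q M} {n : ℕ}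

open Classical in
/-- First moment `k ≥ j` (within the execution) at which process `e` is in an action
state; `|ρ|` if there is none. -/
noncomputable def nextIdx (ρ : Exec P n) (j : ℕ) (e : Fin n) : ℕ∞ :=
  if h : ∃ k : ℕ, j ≤ k ∧ (k : ℕ∞) < ρ.len ∧ ¬ P.isWaiting (ρ.conf k e)
  then (Nat.find h : ℕ∞)
  else ρ.len

open Classical in
/-- The next action state of process `e` after `j`; the uncoverable state `qu` if none. -/
noncomputable def nextSt (qu : Q) (ρ : Exec P n) (j : ℕ) (e : Fin n) : Q :=
  if h : ∃ k : ℕ, j ≤ k ∧ (k : ℕ∞) < ρ.len ∧ ¬ P.isWaiting (ρ.conf k e)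
  then ρ.conf (Nat.find h) e
  else qu

noncomputable def next (qu : Q) (ρ : Exec P n) (j : ℕ) (e : Fin n) : Q × ℕ∞ :=
  (nextSt qu ρ j e, nextIdx ρ j e)

/-- Well-formed executions. -/
def WellFormed (qu : Q) (ρ : Exec P n) : Prop :=
  ∀ i : ℕ, (i : ℕ∞) < ρ.len → ∀ e1 e2 : Fin n,
    ρ.conf i e1 = ρ.conf i e2 → P.isWaiting (ρ.conf i e1) →
    nextSt qu ρ i e1 = nextSt qu ρ i e2 →
    ∀ k : ℕ, i ≤ k → (k : ℕ∞) ≤ nextIdx ρ i e1 → ρ.conf k e1 = ρ.conf k e2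

/-- The set of indices at which some process currently waiting will reach action state `qa`. -/
def nextSet (qu : Q) (ρ : Exec P n) (j : ℕ) (qa : Q) : Set ℕ :=
  {i | ∃ e : Fin n, P.isWaiting (ρ.conf j e) ∧ next qu ρ j e = (qa, (i : ℕ∞))}

end Exec


structure VASS (L X : Type) where
  init : L
  Δ : Set (L × (X → ℤ) × L)

namespace VASS

variable {L X : Type}

/-- One VASS step (counters stay in ℕ by typing). -/
def Step (V : VASS L X) (c c' : L × (X → ℕ)) : Prop :=
  ∃ δ, (c.1, δ, c'.1) ∈ V.Δ ∧ ∀ x, (c'.2 x : ℤ) = (c.2 x : ℤ) + δ x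

def Reach (V : VASS L X) : (L × (X → ℕ)) → (L × (X → ℕ)) → Prop :=
  Relation.ReflTransGen V.Step

end VASS

/-- Every transition changes exactly one counter, by exactly `±1`. -/
def UnitVASS {L X : Type} (V : VASS L X) : Prop :=
  ∀ d ∈ V.Δ, ∃ x : X, (d.2.1 x = 1 ∨ d.2.1 x = -1) ∧ ∀ y, y ≠ x → d.2.1 y = 0

/-- States of the protocol built from a VASS. -/
inductive PVSt (L X : Type) where
  | qin : PVSt L X
  | q1 : PVSt L X
  | zro : PVSt L X
  | zend : PVSt L X
  | lf' : PVSt L X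
  | qf : PVSt L X
  | err : PVSt L X
  | err' : PVSt L X
  | unit : X → PVSt L X
  | loc : L → PVSt L X
  | frown : PVSt L X

/-- Messages of the protocol built from a VASS. -/
inductive PVMsg (X : Type) where
  | start : PVMsg X
  | dollar : PVMsg X
  | fin : PVMsg X
  | verif : PVMsg X
  | inc : X → PVMsg X
  | dec : X → PVMsg X

/-- The Wait-Only protocol `P'_V` built from the VASS `V` for the coverability reduction
(dashed edge `(ℓ, ?start, err)` included, thick edges removed; `q_f` is an action state). -/
def PV' {L X : Type} (V : VASS L X) (lf : L) : Protocol (PVSt L X) (PVMsg X) where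
  qin := .qin
  T := {tr |
    tr = (.qin, Act.send .start, .loc V.init) ∨
    tr = (.qin, Act.send .dollar, .q1) ∨
    tr = (.q1, Act.recv .start, .zro) ∨
    (∃ x, tr = (.zro, Act.send (.inc x), .unit x)) ∨
    (∃ x, tr = (.unit x, Act.send (.dec x), .zro)) ∨
    tr = (.zro, Act.send .fin, .zend) ∨
    tr = (.loc lf, Act.recv .fin, .lf') ∨
    tr = (.lf', Act.send .verif, .qf) ∨
    tr = (.zend, Act.recv .verif, .qf) ∨
    (∃ ℓ : L, tr = (.loc ℓ, Act.recv .start, .err)) ∨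
    (∃ ℓ ℓ' x δ, (ℓ, δ, ℓ') ∈ V.Δ ∧ δ x = 1 ∧ tr = (.loc ℓ, Act.recv (.inc x), .loc ℓ')) ∨
    (∃ ℓ ℓ' x δ, (ℓ, δ, ℓ') ∈ V.Δ ∧ δ x = -1 ∧ tr = (.loc ℓ, Act.recv (.dec x), .loc ℓ')) ∨
    (∃ ℓ x, tr = (.loc ℓ, Act.recv (.inc x), .frown)) ∨
    (∃ ℓ x, tr = (.loc ℓ, Act.recv (.dec x), .frown))}

namespace Protocol

variable {Q M : Type} {P : Protocol Q M} {n : ℕ}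

theorem StepAny.update {C : Fin n → Q} {i : Fin n} {a : M} {q : Q}
    (ht : (C i, Act.send a, q) ∈ P.T) (hC : ∀ j, j ≠ i → a ∉ P.R (C j)) :
    P.StepAny C (Function.update C i q) :=
  ⟨i, _, _, a, q, rfl, ht, rfl, Function.update_self .., fun j hj =>
    Or.inr ⟨hC j hj, Function.update_of_ne hj _ _⟩⟩

/-- Processes that broadcast messages nobody can receive may all move, one after the other. -/
theorem Reach.piecewise (C B : Fin n → Q) (a : Fin n → M) (s : Finset (Fin n))
    (ht : ∀ i ∈ s, (C i, Act.send (a i), B i) ∈ P.T)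
    (hC : ∀ i ∈ s, ∀ j, a i ∉ P.R (C j)) (hB : ∀ i ∈ s, ∀ j ∈ s, a i ∉ P.R (B j)) :
    P.Reach C (s.piecewise B C) := by
  induction s using Finset.induction_on with
  | empty => rw [Finset.piecewise_empty]; exact Relation.ReflTransGen.refl
  | insert i s hi ih =>
    rw [Finset.piecewise_insert]
    refine Relation.ReflTransGen.tail (ih (fun k hk => ht k (Finset.mem_insert_of_mem hk))
      (fun k hk => hC k (Finset.mem_insert_of_mem hk))
      (fun k hk j hj => hB k (Finset.mem_insert_of_mem hk) j (Finset.mem_insert_of_mem hj)))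
      (StepAny.update (a := a i) ?_ ?_)
    · rw [Finset.piecewise_eq_of_notMem _ _ _ hi]
      exact ht i (Finset.mem_insert_self i s)
    · intro j _
      by_cases hj : j ∈ s
      · rw [Finset.piecewise_eq_of_mem _ _ _ hj]
        exact hB i (Finset.mem_insert_self i s) j (Finset.mem_insert_of_mem hj)
      · rw [Finset.piecewise_eq_of_notMem _ _ _ hj]
        exact hC i (Finset.mem_insert_self i s) j

end Protocol

section Count

variable {Q : Type} {n : ℕ}

open Classical in
/-- The number of processes in state `q`. -/
noncomputable def stateCount (C : Fin n → Q) (q : Q) : ℕ :=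
  (Finset.univ.filter fun i => C i = q).card

open Classical in
theorem stateCount_update (C : Fin n → Q) (i : Fin n) (q r : Q) :
    stateCount (Function.update C i q) r + (if C i = r then 1 else 0) =
      stateCount C r + (if q = r then 1 else 0) := by
  unfold stateCount
  rw [Finset.card_filter, Finset.card_filter,
    ← Finset.add_sum_erase _ _ (Finset.mem_univ i),
    ← Finset.add_sum_erase Finset.univ (fun j => if C j = r then 1 else 0) (Finset.mem_univ i),
    Function.update_self]
  have : ∑ j ∈ Finset.univ.erase i, (if Function.update C i q j = r then 1 else 0) =
      ∑ j ∈ Finset.univ.erase i, (if C j = r then 1 else 0) :=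
    Finset.sum_congr rfl fun j hj => by rw [Function.update_of_ne (Finset.ne_of_mem_erase hj)]
  rw [this]
  ring

theorem stateCount_update_of_ne (C : Fin n → Q) (i : Fin n) {q r : Q} (h : C i ≠ r)
    (h' : q ≠ r) : stateCount (Function.update C i q) r = stateCount C r := by
  have := stateCount_update C i q r
  simpa [h, h'] using this

theorem stateCount_update_eq (C : Fin n → Q) (i : Fin n) {q : Q} (h : C i ≠ q) :
    stateCount (Function.update C i q) q = stateCount C q + 1 := by
  have := stateCount_update C i q q
  simpa [h] using this

theorem stateCount_update_eq_of_ne (C : Fin n → Q) (i : Fin n) {q : Q} (h : q ≠ C i) :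
    stateCount (Function.update C i q) (C i) + 1 = stateCount C (C i) := by
  have := stateCount_update C i q (C i)
  simpa [h] using this

theorem stateCount_eq_zero {C : Fin n → Q} {q : Q} (h : ∀ i, C i ≠ q) : stateCount C q = 0 := by
  simp [stateCount, h]

theorem exists_of_stateCount_pos {C : Fin n → Q} {q : Q} (h : 0 < stateCount C q) :
    ∃ i, C i = q := by
  by_contra! hC
  exact h.ne' (stateCount_eq_zero hC)

end Count

section Reduction

variable {L X : Type} {V : VASS L X} {lf : L} {n : ℕ}

theorem UnitVASS.eq_zero_of_ne (hV : UnitVASS V) {l l' : L} {δ : X → ℤ} (h : (l, δ, l') ∈ V.Δ)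
    {x y : X} (hx : δ x ≠ 0) (hy : y ≠ x) : δ y = 0 := by
  obtain ⟨z, -, hz⟩ := hV _ h
  have : x = z := by
    by_contra hxz
    exact hx (hz x hxz)
  exact hz y (this ▸ hy)

theorem PV'.mem_R {q : PVSt L X} {a : PVMsg X} :
    a ∈ (PV' V lf).R q ↔ (q = .q1 ∧ a = .start) ∨ (q = .zend ∧ a = .verif) ∨
      (q = .loc lf ∧ a = .fin) ∨
      ∃ l, q = .loc l ∧ (a = .start ∨ ∃ x, a = .inc x ∨ a = .dec x) := by
  constructor
  · rintro ⟨q', h⟩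
    simp only [PV', Set.mem_ofPred_eq, Prod.mk.injEq, Act.recv.injEq, reduceCtorEq, false_and,
      and_false, exists_false, false_or] at h
    grind
  · rintro (⟨rfl, rfl⟩ | ⟨rfl, rfl⟩ | ⟨rfl, rfl⟩ | ⟨l, rfl, rfl | ⟨x, rfl | rfl⟩⟩)
    · exact ⟨.zro, by simp [PV']⟩
    · exact ⟨.qf, by simp [PV']⟩
    · exact ⟨.lf', by simp [PV']⟩
    · exact ⟨.err, by simp [PV']⟩
    · exact ⟨.frown, by simp [PV']⟩
    · exact ⟨.frown, by simp [PV']⟩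

/-- States of the processes other than the one simulating the control location. -/
def PVSt.IsIdle (q : PVSt L X) : Prop :=
  q = .qin ∨ q = .q1 ∨ q = .zro ∨ q = .zend ∨ ∃ x, q = .unit x

/-- The configuration `C` encodes the VASS configuration `c`, with leader `i`. -/
structure PVEncodes (C : Fin n → PVSt L X) (i : Fin n) (c : L × (X → ℕ)) : Prop where
  leader : C i = .loc c.1
  idle : ∀ j, j ≠ i → (C j).IsIdle
  count : ∀ x, stateCount C (.unit x) = c.2 x

/-- A safe over-approximation of the reachable configurations. -/
def PVInvariant (V : VASS L X) (lf : L) (C : Fin n → PVSt L X) : Prop :=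
  (∃ v, V.Reach (V.init, 0) (lf, v)) ∨ (∃ i, C i = .err ∨ C i = .frown) ∨
    (∀ i, C i = .qin ∨ C i = .q1) ∨ ∃ i c, V.Reach (V.init, 0) c ∧ PVEncodes C i c

/-- A broadcast of `a` leaves a process in state `q` in one of the states `q'`. -/
def PVReact (V : VASS L X) (lf : L) (a : PVMsg X) (q q' : PVSt L X) : Prop :=
  (q, Act.recv a, q') ∈ (PV' V lf).T ∨ (a ∉ (PV' V lf).R q ∧ q' = q)

theorem PVReact.eq {a : PVMsg X} {q q' : PVSt L X} (h : PVReact V lf a q q')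
    (ha : a ∉ (PV' V lf).R q) : q' = q :=
  h.elim (fun h => absurd ⟨q', h⟩ ha) And.right

theorem PVReact.mem {a : PVMsg X} {q q' : PVSt L X} (h : PVReact V lf a q q')
    (ha : a ∈ (PV' V lf).R q) : (q, Act.recv a, q') ∈ (PV' V lf).T :=
  h.resolve_right fun h => h.1 ha

theorem PVSt.IsIdle.notMem_R {q : PVSt L X} (hq : q.IsIdle) {a : PVMsg X}
    (h : a ≠ .start) (h' : a ≠ .verif) : a ∉ (PV' V lf).R q := by
  rw [PV'.mem_R]
  rcases hq with rfl | rfl | rfl | rfl | ⟨x, rfl⟩ <;> simp [h, h']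

theorem PVInvariant.step (hV : UnitVASS V) {C C' : Fin n → PVSt L X}
    (hC : PVInvariant V lf C) (h : (PV' V lf).StepAny C C') : PVInvariant V lf C' := by
  obtain ⟨e, t, q, a, q', rfl, ht, rfl, rfl, hr⟩ := h
  change ∀ j, j ≠ e → PVReact V lf a (C j) (C' j) at hr
  rcases hC with hC | ⟨i, hi⟩ | hC | ⟨i, c, hc, hE⟩
  · exact Or.inl hC
  · refine Or.inr (Or.inl ⟨i, ?_⟩)
    have hie : i ≠ e := by
      rintro rfl
      rcases hi with hi | hi <;> simp [PV', hi] at ht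
    rwa [(hr i hie).eq (by rw [PV'.mem_R]; rcases hi with hi | hi <;> simp [hi])]
  · have hin : C e = .qin := by
      rcases hC e with h | h
      · exact h
      · simp [PV', h] at ht
    simp only [PV', hin, Set.mem_ofPred_eq, Prod.mk.injEq, Act.send.injEq, reduceCtorEq,
      false_and, and_false, exists_false, or_false, true_and] at ht
    rcases ht with ⟨rfl, ht⟩ | ⟨rfl, ht⟩
    · refine Or.inr (Or.inr (Or.inr ⟨e, _, Relation.ReflTransGen.refl, ht, ?_, ?_⟩))
      · intro j hj
        rcases hC j with h | h
        · have := (hr j hj).eq (by simp [PV'.mem_R, h])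
          simp [this, h, PVSt.IsIdle]
        · have := (hr j hj).mem (by simp [PV'.mem_R, h])
          have : C' j = .zro := by simpa [PV', h] using this
          simp [this, PVSt.IsIdle]
      · intro x
        refine stateCount_eq_zero fun j => ?_
        by_cases hj : j = e
        · simp [hj, ht]
        rcases hC j with h | h
        · have := (hr j hj).eq (by simp [PV'.mem_R, h])
          simp [this, h]
        · have := (hr j hj).mem (by simp [PV'.mem_R, h])
          have : C' j = .zro := by simpa [PV', h] using this
          simp [this]
    · refine Or.inr (Or.inr (Or.inl fun j => ?_))
      by_cases hj : j = e
      · simp [hj, ht]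
      rw [(hr j hj).eq (by rcases hC j with h | h <;> simp [PV'.mem_R, h])]
      exact hC j
  · obtain ⟨l, v⟩ := c
    have hl : C i = .loc l := hE.leader
    have hie : i ≠ e := by
      rintro rfl
      simp [PV', hl] at ht
    have hRi := hr i hie
    have hidle := hE.idle e hie.symm
    have hne : ∀ x, C e ≠ .unit x → C' e ≠ .unit x → ∀ l', C' = Function.update
        (Function.update C e (C' e)) i (.loc l') → stateCount C' (.unit x) = v x := by
      intro x h h' l' hu
      rw [hu, stateCount_update_of_ne _ _ (by simp [Function.update_of_ne hie, hl]) (by simp),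
        stateCount_update_of_ne _ _ h h', hE.count]
    have hupd : ∀ l', a ≠ .start → a ≠ .verif → C' i = .loc l' → C' = Function.update
        (Function.update C e (C' e)) i (.loc l') := by
      intro l' h h' hl'
      funext j
      by_cases hj : j = i
      · subst hj; simp [hl']
      rw [Function.update_of_ne hj]
      by_cases hje : j = e
      · subst hje; simp
      rw [Function.update_of_ne hje]
      exact (hr j hje).eq ((hE.idle j hj).notMem_R h h')
    have hidle' : ∀ l', a ≠ .start → a ≠ .verif → C' i = .loc l' → (C' e).IsIdle →
        ∀ j, j ≠ i → (C' j).IsIdle := by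
      intro l' h h' hl' he j hj
      by_cases hje : j = e
      · exact hje ▸ he
      rw [(hr j hje).eq ((hE.idle j hj).notMem_R h h')]
      exact hE.idle j hj
    rcases hidle with h | h | h | h | ⟨x, h⟩ <;>
      simp only [PV', h, Set.mem_ofPred_eq, Prod.mk.injEq, Act.send.injEq, reduceCtorEq,
        false_and, and_false, exists_false, or_false, true_and, false_or] at ht
    · rcases ht with ⟨rfl, ht⟩ | ⟨rfl, ht⟩
      · have := hRi.mem (by simp [PV'.mem_R, hl])
        have : C' i = .err := by simpa [PV', hl] using this
        exact Or.inr (Or.inl ⟨i, Or.inl this⟩)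
      · have hi := (hRi.eq (by simp [PV'.mem_R, hl])).trans hl
        exact Or.inr (Or.inr (Or.inr ⟨i, _, hc, hi,
          hidle' l (by simp) (by simp) hi (by simp [ht, PVSt.IsIdle]),
          fun x => hne x (by simp [h]) (by simp [ht]) l (hupd l (by simp) (by simp) hi)⟩))
    · rcases ht with ⟨x, rfl, ht⟩ | ⟨rfl, ht⟩
      · have := hRi.mem (by simp [PV'.mem_R, hl])
        simp only [PV', hl, Set.mem_ofPred_eq, Prod.mk.injEq, Act.recv.injEq, reduceCtorEq,
          false_and, and_false, exists_false, or_false, false_or, PVMsg.inc.injEq,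
          PVSt.loc.injEq] at this
        rcases this with ⟨_, l', _, δ, hδ, hx, rfl, rfl, hi⟩ | ⟨_, _, -, -, hi⟩
        · refine Or.inr (Or.inr (Or.inr ⟨i, (l', fun y => stateCount C' (.unit y)),
            hc.tail ⟨δ, hδ, fun y => ?_⟩, hi,
            hidle' l' (by simp) (by simp) hi (by simp [ht, PVSt.IsIdle]), fun _ => rfl⟩))
          have hu := hupd l' (by simp) (by simp) hi
          by_cases hy : y = x
          · subst hy
            have h1 : stateCount C' (.unit y) = v y + 1 := by
              rw [hu, ht, stateCount_update_of_ne _ _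
                (by simp [Function.update_of_ne hie, hl]) (by simp),
                stateCount_update_eq _ _ (by simp [h]), hE.count]
            simp [h1, hx]
          · simp [hne y (by simp [h]) (by simpa [ht] using Ne.symm hy) l' hu,
              hV.eq_zero_of_ne hδ (x := x) (by simp [hx]) hy]
        · exact Or.inr (Or.inl ⟨i, Or.inr hi⟩)
      · by_cases hlf : l = lf
        · exact Or.inl ⟨v, hlf ▸ hc⟩
        have hi := (hRi.eq (by simp [PV'.mem_R, hl, hlf])).trans hl
        exact Or.inr (Or.inr (Or.inr ⟨i, _, hc, hi,
          hidle' l (by simp) (by simp) hi (by simp [ht, PVSt.IsIdle]),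
          fun x => hne x (by simp [h]) (by simp [ht]) l (hupd l (by simp) (by simp) hi)⟩))
    · replace ht : a = .dec x ∧ C' e = .zro := by
        obtain ⟨y, hy, ha, hz⟩ := ht
        rw [PVSt.unit.inj hy]
        exact ⟨ha, hz⟩
      obtain ⟨rfl, ht⟩ := ht
      have := hRi.mem (by simp [PV'.mem_R, hl])
      simp only [PV', hl, Set.mem_ofPred_eq, Prod.mk.injEq, Act.recv.injEq, reduceCtorEq,
        false_and, and_false, exists_false, false_or, PVMsg.dec.injEq,
        PVSt.loc.injEq] at this
      rcases this with ⟨_, l', _, δ, hδ, hx, rfl, rfl, hi⟩ | ⟨_, _, -, -, hi⟩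
      · refine Or.inr (Or.inr (Or.inr ⟨i, (l', fun y => stateCount C' (.unit y)),
          hc.tail ⟨δ, hδ, fun y => ?_⟩, hi,
          hidle' l' (by simp) (by simp) hi (by simp [ht, PVSt.IsIdle]), fun _ => rfl⟩))
        have hu := hupd l' (by simp) (by simp) hi
        by_cases hy : y = x
        · subst hy
          have h1 : stateCount C' (.unit y) + 1 = v y := by
            rw [hu, ht, stateCount_update_of_ne _ _
              (by simp [Function.update_of_ne hie, hl]) (by simp), ← h,
              stateCount_update_eq_of_ne _ _ (by simp [h]), h, hE.count]
          simp [← h1, hx]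
        · simp [hne y (by simpa [h] using Ne.symm hy) (by simp [ht]) l' hu,
            hV.eq_zero_of_ne hδ (x := x) (by simp [hx]) hy]
      · exact Or.inr (Or.inl ⟨i, Or.inr hi⟩)

theorem PVInvariant.reach (hV : UnitVASS V) {C C' : Fin n → PVSt L X}
    (hC : PVInvariant V lf C) (h : (PV' V lf).Reach C C') : PVInvariant V lf C' := by
  induction h with
  | refl => exact hC
  | tail _ hs ih => exact ih.step hV hs

/-- `C` encodes `c`, process `0` is the leader and all others are in `zro` or a unit state. -/
structure PVSimulates {N : ℕ} (C : Fin (N + 1) → PVSt L X) (c : L × (X → ℕ)) : Prop where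
  leader : C 0 = .loc c.1
  others : ∀ j, j ≠ 0 → C j = .zro ∨ ∃ x, C j = .unit x
  count : ∀ x, stateCount C (.unit x) = c.2 x

theorem exists_reach_simulates_init (V : VASS L X) (lf : L) (N : ℕ) :
    ∃ C : Fin (N + 1) → PVSt L X, (PV' V lf).Reach (fun _ => .qin) C ∧
      PVSimulates C (V.init, 0) ∧ N ≤ stateCount C .zro := by
  classical
  have h1 := Protocol.Reach.piecewise (P := PV' V lf) (fun _ : Fin (N + 1) => .qin)
    (fun _ => .q1) (fun _ => .dollar) (Finset.univ.erase 0) (by simp [PV'])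
    (by simp [PV'.mem_R]) (by simp [PV'.mem_R])
  refine ⟨Function.update (fun _ => .zro) 0 (.loc V.init), h1.tail ⟨0, _, _, .start, _, rfl, ?_,
    rfl, rfl, ?_⟩, ⟨by simp, ?_, ?_⟩, ?_⟩
  · simp [PV', Finset.piecewise]
  · intro j hj
    left
    simp [PV', Finset.piecewise, hj]
  · intro j hj
    simp [hj]
  · intro x
    refine stateCount_eq_zero fun j => ?_
    by_cases hj : j = 0
    · subst hj; simp
    · simp [hj]
  · have h2 := stateCount_update_eq_of_ne (fun _ : Fin (N + 1) => (PVSt.zro : PVSt L X)) 0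
      (q := .loc V.init) (by simp)
    have h3 : stateCount (fun _ : Fin (N + 1) => (PVSt.zro : PVSt L X)) .zro = N + 1 := by
      simp [stateCount]
    omega

/-- Simulation of one VASS step by a broadcast of process `e` received by the leader. -/
theorem PVSimulates.stepAny {N : ℕ} {C : Fin (N + 1) → PVSt L X} {c : L × (X → ℕ)}
    (hC : PVSimulates C c) {e : Fin (N + 1)} (he : e ≠ 0) {a : PVMsg X} {q : PVSt L X} {l : L}
    (hs : (C e, Act.send a, q) ∈ (PV' V lf).T)
    (hr : (.loc c.1, Act.recv a, .loc l) ∈ (PV' V lf).T) :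
    (PV' V lf).StepAny C (Function.update (Function.update C e q) 0 (.loc l)) := by
  refine ⟨e, _, _, a, q, rfl, hs, rfl, by simp [he], fun j hj => ?_⟩
  by_cases hj0 : j = 0
  · subst hj0
    left
    simpa [hC.leader] using hr
  · right
    rw [Function.update_of_ne hj0, Function.update_of_ne hj, PV'.mem_R]
    rcases hC.others j hj0 with h | ⟨x, h⟩ <;> simp [h]

theorem exists_reach_simulates (hV : UnitVASS V) (lf : L) {c : L × (X → ℕ)}
    (h : V.Reach (V.init, 0) c) :
    ∃ k, ∀ N, k ≤ N → ∃ C : Fin (N + 1) → PVSt L X, (PV' V lf).Reach (fun _ => .qin) C ∧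
      PVSimulates C c ∧ N ≤ stateCount C .zro + k := by
  induction h with
  | refl =>
    exact ⟨0, fun N _ => exists_reach_simulates_init V lf N⟩
  | @tail c c' _ hs ih =>
    obtain ⟨k, ih⟩ := ih
    refine ⟨k + 1, fun N hN => ?_⟩
    obtain ⟨C, hR, hC, hz⟩ := ih N (by omega)
    obtain ⟨δ, hδ, hc'⟩ := hs
    have hC0 : ∀ e q, e ≠ 0 → ∀ r, (∀ l, r ≠ .loc l) →
        stateCount (Function.update (Function.update C e q) 0 (.loc c'.1)) r =
          stateCount (Function.update C e q) r := fun e q he r hr =>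
      stateCount_update_of_ne _ _ (by rw [Function.update_of_ne he.symm, hC.leader]
                                      exact (hr _).symm) (hr _).symm
    have hoth : ∀ e q, (q = .zro ∨ ∃ x, q = .unit x) → ∀ j, j ≠ 0 →
        let C' := Function.update (Function.update C e q) 0 (.loc c'.1)
        C' j = .zro ∨ ∃ x, C' j = .unit x := by
      intro e q hq j hj
      simp only [Function.update_of_ne hj]
      by_cases hje : j = e
      · subst hje; simpa using hq
      · rw [Function.update_of_ne hje]; exact hC.others j hj
    obtain ⟨x, hx | hx, hδ0⟩ := hV _ hδ <;> dsimp only at hx hδ0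
    · obtain ⟨e, he⟩ := exists_of_stateCount_pos (C := C) (q := .zro) (by omega)
      have he0 : e ≠ 0 := by rintro rfl; simp [hC.leader] at he
      refine ⟨_, hR.tail (hC.stepAny (V := V) (lf := lf) he0 (a := .inc x) (q := .unit x)
        (l := c'.1) (by simp [PV', he]) ?_), ⟨by simp, hoth e _ (by simp), fun y => ?_⟩, ?_⟩
      · simpa [PV'] using ⟨δ, hδ, hx⟩
      · rw [hC0 e _ he0 _ (by simp)]
        have hy := hc' y
        by_cases hyx : y = x
        · subst hyx
          rw [stateCount_update_eq _ _ (by simp [he]), hC.count]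
          omega
        · rw [stateCount_update_of_ne _ _ (by simp [he]) (by simpa using Ne.symm hyx), hC.count]
          have := hδ0 y hyx
          omega
      · rw [hC0 e _ he0 _ (by simp)]
        have := stateCount_update_eq_of_ne C e (q := .unit x) (by simp [he])
        rw [he] at this
        omega
    · have hxx := hc' x
      obtain ⟨e, he⟩ := exists_of_stateCount_pos (C := C) (q := .unit x) (by
        rw [hC.count]; omega)
      have he0 : e ≠ 0 := by rintro rfl; simp [hC.leader] at he
      refine ⟨_, hR.tail (hC.stepAny (V := V) (lf := lf) he0 (a := .dec x) (q := .zro)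
        (l := c'.1) (by simp [PV', he]) ?_), ⟨by simp, hoth e _ (by simp), fun y => ?_⟩, ?_⟩
      · simpa [PV'] using ⟨δ, hδ, hx⟩
      · rw [hC0 e _ he0 _ (by simp)]
        have hy := hc' y
        by_cases hyx : y = x
        · subst hyx
          have := stateCount_update_eq_of_ne C e (q := .zro) (by simp [he])
          rw [he, hC.count] at this
          omega
        · rw [stateCount_update_of_ne _ _ (by simpa [he] using Ne.symm hyx) (by simp), hC.count]
          have := hδ0 y hyx
          omega
      · rw [hC0 e _ he0 _ (by simp), stateCount_update_eq _ _ (by simp [he])]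
        omega

/-- Once the leader is in `lf`, all processes can gather in `qf`. -/
theorem PVSimulates.reach_qf {N : ℕ} {C : Fin (N + 1) → PVSt L X} {v : X → ℕ}
    (hC : PVSimulates C (lf, v)) (hz : 0 < stateCount C .zro) :
    (PV' V lf).Reach C (fun _ => .qf) := by
  classical
  obtain ⟨e, he⟩ := exists_of_stateCount_pos hz
  have hl : C 0 = .loc lf := hC.leader
  have he0 : e ≠ 0 := by rintro rfl; simp [hl] at he
  set C₁ : Fin (N + 1) → PVSt L X := Function.update (Function.update C e .zend) 0 .lf' with hC₁
  have hC₁0 : C₁ 0 = .lf' := by simp [hC₁]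
  have hC₁j : ∀ j, j ≠ 0 → C₁ j = .zend ∨ C₁ j = .zro ∨ ∃ x, C₁ j = .unit x := by
    intro j hj
    rw [hC₁, Function.update_of_ne hj]
    by_cases hje : j = e
    · subst hje; simp
    · rw [Function.update_of_ne hje]; exact Or.inr (hC.others j hj)
  have h1 : (PV' V lf).StepAny C C₁ := by
    refine ⟨e, _, _, .fin, .zend, rfl, by simp [PV', he], rfl, by simp [hC₁, he0], fun j hj => ?_⟩
    by_cases hj0 : j = 0
    · subst hj0
      left
      simp [PV', hl, hC₁0]
    · right
      rw [hC₁, Function.update_of_ne hj0, Function.update_of_ne hj, PV'.mem_R]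
      rcases hC.others j hj0 with h | ⟨x, h⟩ <;> simp [h]
  have hR₁ : ∀ (a : PVMsg X), a ≠ .verif → ∀ j, a ∉ (PV' V lf).R (C₁ j) := by
    intro a ha j
    rw [PV'.mem_R]
    by_cases hj : j = 0
    · subst hj; simp [hC₁0]
    · rcases hC₁j j hj with h | h | ⟨x, h⟩ <;> simp [h, ha]
  have hmsg : ∀ j, ∃ a : PVMsg X, a ≠ .verif ∧ ∀ x, C₁ j = .unit x → a = .dec x := by
    intro j
    by_cases h : ∃ x, C₁ j = .unit x
    · obtain ⟨x, h⟩ := h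
      exact ⟨.dec x, by simp, fun y hy => by simpa [h] using hy⟩
    · exact ⟨.start, by simp, fun x hx => (h ⟨x, hx⟩).elim⟩
  choose a ha hau using hmsg
  set C₂ := (Finset.univ.filter fun j => ∃ x, C₁ j = .unit x).piecewise (fun _ => .zro) C₁
    with hC₂
  have h2 : (PV' V lf).Reach C₁ C₂ := by
    refine Protocol.Reach.piecewise _ _ a _ ?_ (fun i _ => hR₁ _ (ha i)) (by simp [PV'.mem_R])
    intro i hi
    obtain ⟨x, hx⟩ := (Finset.mem_filter.1 hi).2
    rw [hx, hau i x hx]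
    simp [PV']
  have hC₂0 : C₂ 0 = .lf' := by
    rw [hC₂, Finset.piecewise_eq_of_notMem _ _ _ (by simp [hC₁0]), hC₁0]
  have hC₂j : ∀ j, j ≠ 0 → C₂ j = .zend ∨ C₂ j = .zro := by
    intro j hj
    by_cases h : ∃ x, C₁ j = .unit x
    · rw [hC₂, Finset.piecewise_eq_of_mem _ _ _ (by simpa using h)]
      simp
    · rw [hC₂, Finset.piecewise_eq_of_notMem _ _ _ (by simpa using h)]
      have := hC₁j j hj
      tauto
  set C₃ := (Finset.univ.filter fun j => C₂ j = .zro).piecewise (fun _ => .zend) C₂ with hC₃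
  have h3 : (PV' V lf).Reach C₂ C₃ := by
    refine Protocol.Reach.piecewise _ _ (fun _ => .fin) _ ?_ (fun i _ j => ?_)
      (by simp [PV'.mem_R])
    · intro i hi
      rw [(Finset.mem_filter.1 hi).2]
      simp [PV']
    · rw [PV'.mem_R]
      by_cases hj : j = 0
      · subst hj; simp [hC₂0]
      · rcases hC₂j j hj with h | h <;> simp [h]
  have hC₃0 : C₃ 0 = .lf' := by
    rw [hC₃, Finset.piecewise_eq_of_notMem _ _ _ (by simp [hC₂0]), hC₂0]
  have hC₃j : ∀ j, j ≠ 0 → C₃ j = .zend := by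
    intro j hj
    rcases hC₂j j hj with h | h
    · rw [hC₃, Finset.piecewise_eq_of_notMem _ _ _ (by simp [h]), h]
    · rw [hC₃, Finset.piecewise_eq_of_mem _ _ _ (by simp [h])]
  have h4 : (PV' V lf).StepAny C₃ (fun _ => .qf) :=
    ⟨0, _, _, .verif, _, rfl, by simp [PV', hC₃0], rfl, rfl,
      fun j hj => Or.inl (by simp [PV', hC₃j j hj])⟩
  exact ((Relation.ReflTransGen.single h1).trans (h2.trans h3)).tail h4

end Reduction

/-- **Correctness of the ExpSpace-hardness reduction.** The location `ℓ_f` is coverable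
in `V` iff all processes of `P'_V` can gather in the action state `q_f`. -/
theorem coverable_iff_synchro {L X : Type} [Fintype L] [Fintype X]
    (V : VASS L X) (lf : L) (hunit : UnitVASS V) :
    (∃ v : X → ℕ, V.Reach (V.init, 0) (lf, v)) ↔
    (∃ (n : ℕ), 0 < n ∧ ∃ C0 Cf : Fin n → PVSt L X,
       (PV' V lf).Initial C0 ∧ (PV' V lf).Reach C0 Cf ∧ ∀ e, Cf e = PVSt.qf) := by
  constructor
  · rintro ⟨v, hv⟩
    obtain ⟨k, hk⟩ := exists_reach_simulates hunit lf hv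
    obtain ⟨C, hR, hC, hz⟩ := hk (k + 1) (by omega)
    exact ⟨k + 1 + 1, by omega, _, _, fun _ => rfl, hR.trans (hC.reach_qf (by omega)),
      fun _ => rfl⟩
  · rintro ⟨n, hn, C0, Cf, h0, hR, hf⟩
    have hinv : PVInvariant V lf C0 := Or.inr (Or.inr (Or.inl fun i => Or.inl (h0 i)))
    rcases hinv.reach hunit hR with h | ⟨i, hi⟩ | h | ⟨i, c, -, hE⟩
    · exact h
    · simp [hf] at hi
    · simpa [hf] using h ⟨0, hn⟩
    · simpa [hf] using hE.leader
end

section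
/- Let A_1, …, A_n be deterministic complete finite automata over a common alphabet A, each with a unique accepting state, and let P be the associated protocol with distinguished broadcast transition t_f = (q_{n+2}, !!☺, q_1). If there exists a word w ∈ ⋂_{1 ≤ i ≤ n} L(A_i), then there exist an infinite execution ρ of P and a process e ∈ [1, nb(ρ)] such that for all i ∈ N there exists j > i with ρ_j →^{e, t_f} ρ_{j+1}. -/
set_option maxHeartbeats 1000000

/-- States of the protocol built from the automata `A_1, …, A_n`. -/
inductive ASt (n : ℕ) (Qa : Fin n → Type) where
  | qin : ASt n Qa
  | qk : Fin (n + 2) → ASt n Qa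
  | frown : ASt n Qa
  | auto : (i : Fin n) → Qa i → ASt n Qa
  | dSt : Fin n → ASt n Qa
  | eSt : Fin n → ASt n Qa

/-- Messages of the protocol built from the automata. -/
inductive AMsg (n : ℕ) (A : Type) where
  | letter : A → AMsg n A
  | hash : AMsg n A
  | dollar : AMsg n A
  | smiley : AMsg n A
  | idx : Fin n → AMsg n A
  | endm : Fin n → AMsg n A

/-- The protocol associated to the deterministic complete automata
`A_i = (A, Qa i, qa0 i, {qaf i}, δa i)` (indices are 0-based: `qk ⟨j-1,_⟩` is the paper's
`q_j`, and `endm i`, `idx i`, `qa0 i`, … refer to the paper's automaton `i+1`). -/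
def AutoProt (n : ℕ) {A : Type} (Qa : Fin n → Type)
    (δa : ∀ i, Qa i → A → Qa i) (qa0 qaf : ∀ i, Qa i) :
    Protocol (ASt n Qa) (AMsg n A) where
  qin := .qin
  T := {tr |
    tr = (.qin, Act.send .hash, .qk ⟨0, by omega⟩) ∨
    (∃ i : Fin n, tr = (.qin, Act.send (.idx i), .auto i (qa0 i))) ∨
    (∃ a : A, tr = (.qin, Act.send (.letter a), .qin)) ∨
    tr = (.qin, Act.send .dollar, .qin) ∨
    tr = (.qk ⟨0, by omega⟩, Act.recv .dollar, .qk ⟨1, by omega⟩) ∨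
    (∃ i : Fin n,
      tr = (.qk ⟨i.val + 1, by omega⟩, Act.recv (.endm i), .qk ⟨i.val + 2, by omega⟩)) ∨
    tr = (.qk ⟨n + 1, by omega⟩, Act.send .smiley, .qk ⟨0, by omega⟩) ∨
    tr = (.qk ⟨0, by omega⟩, Act.recv .hash, .frown) ∨
    (∃ i : Fin n, tr = (.qk ⟨0, by omega⟩, Act.recv (.endm i), .frown)) ∨
    (∃ (k : Fin (n + 2)) (m : AMsg n A),
      1 ≤ k.val ∧ k.val ≤ n ∧ tr = (.qk k, Act.recv m, .frown)) ∨
    (∃ (i : Fin n) (p : Qa i) (a : A),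
      tr = (.auto i p, Act.recv (.letter a), .auto i (δa i p a))) ∨
    (∃ (i : Fin n) (p : Qa i), tr = (.auto i p, Act.recv .dollar, .frown)) ∨
    (∃ (i : Fin n) (p : Qa i), tr = (.auto i p, Act.recv (.idx i), .frown)) ∨
    (∃ (i : Fin n) (p : Qa i) (j : Fin n), tr = (.auto i p, Act.recv (.endm j), .frown)) ∨
    (∃ i : Fin n, tr = (.auto i (qaf i), Act.recv .dollar, .dSt i)) ∨
    (∃ i : Fin n, tr = (.dSt i, Act.send (.endm i), .eSt i)) ∨
    (∃ i : Fin n, tr = (.eSt i, Act.recv .smiley, .auto i (qa0 i))) ∨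
    (∃ (i : Fin n) (m : AMsg n A),
      m ≠ AMsg.smiley ∧ (∀ j : Fin n, m = AMsg.endm j → j.val ≤ i.val) ∧
      tr = (.eSt i, Act.recv m, .frown))}

namespace Protocol

variable {Q M : Type}

/-- The effect of a broadcast of `a` on a process other than the sender. -/
def Receives (P : Protocol Q M) (a : M) (q q' : Q) : Prop :=
  (q, Act.recv a, q') ∈ P.T ∨ (a ∉ P.R q ∧ q' = q)

theorem Step.stepAny {P : Protocol Q M} {n : ℕ} {e : Fin n} {t : Q × Act M × Q}
    {C C' : Fin n → Q} (h : P.Step e t C C') : P.StepAny C C' :=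
  ⟨e, t, h⟩

end Protocol

theorem Relation.ReflTransGen.exists_path {α : Type*} {r : α → α → Prop} {a b : α}
    (h : Relation.ReflTransGen r a b) :
    ∃ (k : ℕ) (f : ℕ → α), f 0 = a ∧ f k = b ∧ ∀ i < k, r (f i) (f (i + 1)) := by
  induction h with
  | refl => exact ⟨0, fun _ => a, rfl, rfl, by simp⟩
  | @tail b c _ hbc ih =>
    obtain ⟨k, f, h0, hk, hf⟩ := ih
    refine ⟨k + 1, fun i => if i ≤ k then f i else c, by simp [h0], by simp, fun i hi => ?_⟩
    rcases Nat.lt_succ_iff_lt_or_eq.mp hi with h | rfl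
    · have h1 : i ≤ k := h.le
      have h2 : i + 1 ≤ k := h
      simpa [h1, h2] using hf i h
    · simpa [hk] using hbc

/-- A reachable cycle can be unfolded into an infinite execution that takes the closing
transition of the cycle infinitely often. -/
theorem Exec.exists_of_cycle {Q M : Type} {P : Protocol Q M} {n : ℕ} {e : Fin n}
    {t : Q × Act M × Q} {C₀ C D : Fin n → Q} (h₀ : P.Initial C₀) (hC : P.Reach C₀ C)
    (hD : P.Reach C D) (ht : P.Step e t D C) :
    ∃ ρ : Exec P n, ρ.len = ⊤ ∧
      ∀ i : ℕ, ∃ j : ℕ, i < j ∧ P.Step e t (ρ.conf j) (ρ.conf (j + 1)) := by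
  obtain ⟨m, g, g0, gm, hg⟩ := Relation.ReflTransGen.exists_path hC
  obtain ⟨k, f, f0, fk, hf⟩ := Relation.ReflTransGen.exists_path hD
  set conf : ℕ → Fin n → Q := fun i => if i < m then g i else f ((i - m) % (k + 1)) with hconf
  have low : ∀ i ≤ m, conf i = g i := by
    intro i hi
    rcases hi.lt_or_eq with h | rfl
    · simp [hconf, h]
    · simp [hconf, f0, gm]
  have high : ∀ q r, r ≤ k → conf (m + (k + 1) * q + r) = f r := by
    intro q r hr
    have h1 : ¬ m + (k + 1) * q + r < m := by omega
    have h2 : m + (k + 1) * q + r - m = r + (k + 1) * q := by omega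
    simp only [hconf, h1, if_false, h2, Nat.add_mul_mod_self_left]
    rw [Nat.mod_eq_of_lt (by omega)]
  have close : ∀ q, P.Step e t (conf (m + (k + 1) * q + k)) (conf (m + (k + 1) * q + k + 1)) := by
    intro q
    have h1 : m + (k + 1) * q + k + 1 = m + (k + 1) * (q + 1) + 0 := by ring
    rw [high q k le_rfl, h1, high (q + 1) 0 (Nat.zero_le k), fk, f0]
    exact ht
  refine ⟨⟨e.pos, ⊤, le_top, conf, ?_, fun i _ => ?_⟩, rfl, fun i => ?_⟩
  · rw [low 0 (Nat.zero_le m), g0]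
    exact h₀
  · rcases lt_or_ge i m with h | h
    · rw [low i h.le, low (i + 1) h]
      exact hg i h
    · obtain ⟨q, r, hr, rfl⟩ : ∃ q r, r ≤ k ∧ i = m + (k + 1) * q + r := by
        refine ⟨(i - m) / (k + 1), (i - m) % (k + 1),
          Nat.lt_succ_iff.mp (Nat.mod_lt _ (Nat.succ_pos k)), ?_⟩
        have := Nat.div_add_mod (i - m) (k + 1)
        omega
      rcases hr.lt_or_eq with h' | rfl
      · rw [high q r hr, add_assoc, high q (r + 1) h']
        exact hf r h'
      · exact (close q).stepAny
  · refine ⟨m + (k + 1) * (i + 1) + k, ?_, close (i + 1)⟩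
    nlinarith [Nat.zero_le m, Nat.zero_le k, Nat.zero_le (k * i)]

namespace AutoProt

variable {A : Type} {n : ℕ} {Qa : Fin n → Type} {δa : ∀ i, Qa i → A → Qa i}
  {qa0 qaf : ∀ i, Qa i}

/-- The configuration with process `0` in state `x`, process `1` in the initial state, and
process `i + 2` in state `c i`. -/
def mkConf (x : ASt n Qa) (c : Fin n → ASt n Qa) : Fin (n + 2) → ASt n Qa :=
  Fin.cons x (Fin.cons .qin c)

theorem forall_process {p : Fin (n + 2) → Prop} :
    (∀ e, p e) ↔ p 0 ∧ p 1 ∧ ∀ i : Fin n, p i.succ.succ := by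
  rw [Fin.forall_fin_succ, Fin.forall_fin_succ]
  rfl

local notation "𝒫" => AutoProt n Qa δa qa0 qaf

theorem receives_qin (a : AMsg n A) : Protocol.Receives 𝒫 a .qin .qin :=
  Or.inr ⟨by rintro ⟨q', h⟩; simp [AutoProt] at h, rfl⟩

theorem step_zero {a : AMsg n A} {x x' : ASt n Qa} {c c' : Fin n → ASt n Qa}
    (ht : (x, Act.send a, x') ∈ Protocol.T 𝒫) (hc : ∀ i, Protocol.Receives 𝒫 a (c i) (c' i)) :
    Protocol.Step 𝒫 0 (x, Act.send a, x') (mkConf x c) (mkConf x' c') :=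
  ⟨x, a, x', rfl, ht, rfl, rfl, forall_process.mpr
    ⟨fun h => absurd rfl h, fun _ => receives_qin a, fun i _ => hc i⟩⟩

theorem step_one {a : AMsg n A} {x x' : ASt n Qa} {c c' : Fin n → ASt n Qa}
    (ht : (.qin, Act.send a, .qin) ∈ Protocol.T 𝒫) (hx : Protocol.Receives 𝒫 a x x')
    (hc : ∀ i, Protocol.Receives 𝒫 a (c i) (c' i)) :
    Protocol.StepAny 𝒫 (mkConf x c) (mkConf x' c') :=
  ⟨1, _, .qin, a, .qin, rfl, ht, rfl, rfl, forall_process.mpr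
    ⟨fun _ => hx, fun h => absurd rfl h, fun i _ => hc i⟩⟩

theorem step_succ_succ {a : AMsg n A} {x x' : ASt n Qa} {c c' : Fin n → ASt n Qa} (i : Fin n)
    (ht : (c i, Act.send a, c' i) ∈ Protocol.T 𝒫) (hx : Protocol.Receives 𝒫 a x x')
    (hc : ∀ j, j ≠ i → Protocol.Receives 𝒫 a (c j) (c' j)) :
    Protocol.StepAny 𝒫 (mkConf x c) (mkConf x' c') :=
  ⟨i.succ.succ, _, c i, a, c' i, rfl, ht, rfl, rfl, forall_process.mpr
    ⟨fun _ => hx, fun _ => receives_qin a, fun j hj => hc j fun h => hj (by rw [h])⟩⟩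

/-- From the initial configuration, process `0` enters the counter and process `i + 2` enters
automaton `i`. -/
theorem reach_start : Protocol.Reach 𝒫 (mkConf .qin fun _ => .qin)
    (mkConf (.qk ⟨0, by omega⟩) fun i => .auto i (qa0 i)) := by
  have key : ∀ k ≤ n, Protocol.Reach 𝒫 (mkConf .qin fun _ => .qin)
      (mkConf (.qk ⟨0, by omega⟩)
        fun i => if i.val < k then .auto i (qa0 i) else .qin) := by
    intro k
    induction k with
    | zero =>
      intro _
      refine .single (step_zero (a := .hash) ?_ fun i => ?_).stepAny
      · simp [AutoProt]
      · simpa using receives_qin _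
    | succ k ih =>
      intro hk
      refine (ih (by omega)).tail (step_succ_succ (a := .idx ⟨k, hk⟩) ⟨k, hk⟩ ?_ ?_ ?_)
      · simp [AutoProt]
      · exact Or.inr ⟨by rintro ⟨q', h⟩; simp [AutoProt] at h, rfl⟩
      · intro j hj
        have hne : j.val ≠ k := fun h => hj (Fin.ext h)
        rcases lt_or_gt_of_ne hne with h | h
        · rw [if_pos h, if_pos (by omega)]
          refine Or.inr ⟨?_, rfl⟩
          rintro ⟨q', h'⟩
          simp [AutoProt] at h'
          grind
        · rw [if_neg (by omega), if_neg (by omega)]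
          exact receives_qin _
  simpa using key n le_rfl

/-- Process `1` feeds the word `w` to all automata. -/
theorem reach_word (w : List A) (p : ∀ i, Qa i) : Protocol.Reach 𝒫
    (mkConf (.qk ⟨0, by omega⟩) fun i => .auto i (p i))
    (mkConf (.qk ⟨0, by omega⟩) fun i => .auto i (w.foldl (δa i) (p i))) := by
  induction w generalizing p with
  | nil => exact .refl
  | cons a w ih =>
    refine .head (step_one (a := .letter a) ?_ ?_ fun i => Or.inl ?_) (ih fun i => δa i (p i) a)
    · simp [AutoProt]
    · exact Or.inr ⟨by rintro ⟨q', h⟩; simp [AutoProt] at h, rfl⟩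
    · simp only [AutoProt, Set.mem_ofPred_eq]
      iterate 10 right
      exact Or.inl ⟨i, p i, a, rfl⟩

theorem stepAny_dollar : Protocol.StepAny 𝒫
    (mkConf (.qk ⟨0, by omega⟩) fun i => .auto i (qaf i))
    (mkConf (.qk ⟨1, by omega⟩) fun i => .dSt i) := by
  refine step_one (a := .dollar) ?_ (Or.inl ?_) fun i => Or.inl ?_
  · simp [AutoProt]
  · simp [AutoProt]
  · simp only [AutoProt, Set.mem_ofPred_eq]
    iterate 14 right
    exact Or.inl ⟨i, rfl⟩

/-- The processes in the automata report the end of the word in increasing order. -/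
theorem reach_ends : Protocol.Reach 𝒫
    (mkConf (.qk ⟨1, by omega⟩) fun i => .dSt i)
    (mkConf (.qk ⟨n + 1, by omega⟩) fun i => .eSt i) := by
  have key : ∀ (k : ℕ) (hk : k ≤ n), Protocol.Reach 𝒫
      (mkConf (.qk ⟨1, by omega⟩) fun i => .dSt i)
      (mkConf (.qk ⟨k + 1, by omega⟩) fun i => if i.val < k then .eSt i else .dSt i) := by
    intro k
    induction k with
    | zero =>
      intro _
      simp only [Nat.not_lt_zero, if_false]
      exact .refl
    | succ k ih =>
      intro hk
      refine (ih (by omega)).tail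
        (step_succ_succ (a := .endm ⟨k, hk⟩) ⟨k, hk⟩ ?_ (Or.inl ?_) fun j hj => ?_)
      · simp [AutoProt]
      · simp only [AutoProt, Set.mem_ofPred_eq]
        iterate 5 right
        exact Or.inl ⟨⟨k, hk⟩, rfl⟩
      · have hne : j.val ≠ k := fun h => hj (Fin.ext h)
        rcases lt_or_gt_of_ne hne with h | h
        · rw [if_pos h, if_pos (by omega)]
          refine Or.inr ⟨?_, rfl⟩
          rintro ⟨q', h'⟩
          simp [AutoProt] at h'
          exact absurd (Fin.le_def.mp h'.1) (Nat.not_le.mpr h)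
        · rw [if_neg (by omega), if_neg (by omega)]
          exact Or.inr ⟨by rintro ⟨q', h'⟩; simp [AutoProt] at h', rfl⟩
  simpa using key n le_rfl

theorem step_smiley : Protocol.Step 𝒫 0
    (.qk ⟨n + 1, by omega⟩, Act.send .smiley, .qk ⟨0, by omega⟩)
    (mkConf (.qk ⟨n + 1, by omega⟩) fun i => .eSt i)
    (mkConf (.qk ⟨0, by omega⟩) fun i => .auto i (qa0 i)) := by
  refine step_zero ?_ fun i => Or.inl ?_
  · simp [AutoProt]
  · simp only [AutoProt, Set.mem_ofPred_eq]
    iterate 16 right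
    exact Or.inl ⟨i, rfl⟩

end AutoProt

/-- **From a common word to repeated coverability.** If some word is accepted by every
automaton `A_i`, then the associated protocol has an infinite execution in which one
process takes the transition `t_f = (q_{n+2}, !!☺, q_1)` infinitely often. -/
theorem word_to_repeated_coverability {A : Type} [Fintype A] {n : ℕ}
    (Qa : Fin n → Type) [∀ i, Fintype (Qa i)]
    (δa : ∀ i, Qa i → A → Qa i) (qa0 qaf : ∀ i, Qa i)
    (w : List A) (hw : ∀ i : Fin n, w.foldl (δa i) (qa0 i) = qaf i) :
    ∃ (N : ℕ) (ρ : Exec (AutoProt n Qa δa qa0 qaf) N), ρ.len = ⊤ ∧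
      ∃ e : Fin N, ∀ i : ℕ, ∃ j : ℕ, i < j ∧
        (AutoProt n Qa δa qa0 qaf).Step e
          (ASt.qk ⟨n + 1, by omega⟩, Act.send AMsg.smiley, ASt.qk ⟨0, by omega⟩)
          (ρ.conf j) (ρ.conf (j + 1)) := by
  have hloop : (AutoProt n Qa δa qa0 qaf).Reach
      (AutoProt.mkConf (.qk ⟨0, by omega⟩) fun i => .auto i (qa0 i))
      (AutoProt.mkConf (.qk ⟨n + 1, by omega⟩) fun i => .eSt i) := by
    have h := AutoProt.reach_word (δa := δa) (qa0 := qa0) (qaf := qaf) w qa0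
    simp only [hw] at h
    exact (h.tail AutoProt.stepAny_dollar).trans AutoProt.reach_ends
  have hinit : (AutoProt n Qa δa qa0 qaf).Initial (AutoProt.mkConf .qin fun _ => .qin) :=
    AutoProt.forall_process.mpr ⟨rfl, rfl, fun _ => rfl⟩
  obtain ⟨ρ, hρ, h⟩ :=
    Exec.exists_of_cycle hinit AutoProt.reach_start hloop AutoProt.step_smiley
  exact ⟨n + 2, ρ, hρ, 0, h⟩
end

section
/- Let A_1, …, A_n be deterministic complete finite automata over a common alphabet A, each with a unique accepting state, and let P be the associated protocol with distinguished broadcast transition t_f = (q_{n+2}, !!☺, q_1). If there exist an infinite execution ρ of P and a process e ∈ [1, nb(ρ)] such that for all i ∈ N there exists j > i with ρ_j →^{e, t_f} ρ_{j+1}, then ⋂_{1 ≤ i ≤ n} L(A_i) ≠ ∅. -/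
set_option maxHeartbeats 1000000

namespace Protocol

variable {Q M : Type}

theorem StepAny.exists_sender {P : Protocol Q M} {n : ℕ} {C C' : Fin n → Q}
    (h : P.StepAny C C') :
    ∃ s a, (C s, Act.send a, C' s) ∈ P.T ∧ ∀ p, p ≠ s → P.Receives a (C p) (C' p) := by
  obtain ⟨s, t, q, a, q', rfl, ht, rfl, rfl, hr⟩ := h
  exact ⟨s, a, ht, hr⟩

end Protocol

/-- Finitely many predicates that are preserved by successor are eventually constant. -/
theorem exists_forall_ge_of_succ_imp {ι : Type} [Finite ι] (f : ι → ℕ → Prop)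
    (hf : ∀ p s, f p s → f p (s + 1)) :
    ∃ t, ∀ s, t ≤ s → ∀ p, f p (s + 1) → f p s := by
  have key : ∀ p, ∀ᶠ s in Filter.atTop, f p (s + 1) → f p s := by
    intro p
    by_cases h : ∃ s, f p s
    · obtain ⟨s, hs⟩ := h
      filter_upwards [Filter.eventually_ge_atTop s] with r hr _
      exact Nat.le_induction hs (fun k _ hk => hf p k hk) r hr
    · exact Filter.Eventually.of_forall fun s hs => (h ⟨_, hs⟩).elim
  exact Filter.eventually_atTop.1 (Filter.eventually_all.2 key)

namespace AutoProt

open Protocol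

variable {n N : ℕ} {A : Type} {Qa : Fin n → Type} {δa : ∀ i, Qa i → A → Qa i}
  {qa0 qaf : ∀ i, Qa i}

theorem frown_of_receives {m : AMsg n A} {q : ASt n Qa}
    (h : (AutoProt n Qa δa qa0 qaf).Receives m .frown q) : q = .frown := by
  rcases h with h | h
  · simp [AutoProt] at h
  · exact h.2

theorem not_send_frown {m : AMsg n A} {q : ASt n Qa} :
    (ASt.frown, Act.send m, q) ∉ (AutoProt n Qa δa qa0 qaf).T := by
  simp [AutoProt]

theorem eq_qin_of_receives {m : AMsg n A} {q : ASt n Qa}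
    (h : (AutoProt n Qa δa qa0 qaf).Receives m q .qin) : q = .qin := by
  rcases h with h | h
  · simp [AutoProt] at h
  · exact h.2.symm

theorem eq_qin_of_send {m : AMsg n A} {q : ASt n Qa}
    (h : (q, Act.send m, ASt.qin) ∈ (AutoProt n Qa δa qa0 qaf).T) : q = .qin := by
  simp [AutoProt] at h
  grind

theorem send_cases {m : AMsg n A} {q q' : ASt n Qa}
    (h : (q, Act.send m, q') ∈ (AutoProt n Qa δa qa0 qaf).T) (hq : q = .qin → q' = .qin) :
    (q = .qin ∧ ((∃ a, m = .letter a) ∨ m = .dollar)) ∨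
    (q = .qk (Fin.last (n + 1)) ∧ m = .smiley ∧ q' = .qk 0) ∨
    ∃ i, q = .dSt i ∧ m = .endm i ∧ q' = .eSt i := by
  simp only [AutoProt, Set.mem_ofPred_eq, Prod.mk.injEq, Act.send.injEq, reduceCtorEq,
    false_and, and_false, exists_false, or_false, false_or] at h
  rcases h with ⟨rfl, rfl, rfl⟩ | ⟨i, rfl, rfl, rfl⟩ | ⟨a, rfl, rfl, rfl⟩ | ⟨rfl, rfl, rfl⟩ |
    ⟨rfl, rfl, rfl⟩ | ⟨i, rfl, rfl, rfl⟩
  · simp at hq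
  · simp at hq
  · simp
  · simp
  · exact .inr (.inl ⟨rfl, rfl, rfl⟩)
  · simp

theorem receives_qk_zero {m : AMsg n A} {q' : ASt n Qa}
    (h : (AutoProt n Qa δa qa0 qaf).Receives m (.qk 0) q') (hq : q' ≠ .frown) :
    (m = .dollar ∧ q' = .qk 1) ∨ (m ≠ .dollar ∧ q' = .qk 0) := by
  rcases h with h | ⟨h, rfl⟩
  · left
    simp only [AutoProt, Set.mem_ofPred_eq, Prod.mk.injEq, Act.recv.injEq, reduceCtorEq,
      false_and, and_false, exists_false, or_false, false_or, ASt.qk.injEq] at h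
    rcases h with ⟨-, rfl, rfl⟩ | ⟨i, h, -⟩ | h | ⟨_, h⟩ | ⟨_, _, _, _, h⟩
    · exact ⟨rfl, rfl⟩
    · simp [Fin.ext_iff] at h
    · exact (hq h.2.2).elim
    · exact (hq h.2.2).elim
    · exact (hq h.2.2).elim
  · right
    refine ⟨?_, rfl⟩
    rintro rfl
    exact h ⟨.qk 1, .inr (.inr (.inr (.inr (.inl rfl))))⟩

theorem receives_qk_mid {m : AMsg n A} {x : Fin (n + 2)} {q' : ASt n Qa}
    (h : (AutoProt n Qa δa qa0 qaf).Receives m (.qk x) q') (hq : q' ≠ .frown)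
    (h1 : 1 ≤ x.val) (h2 : x.val ≤ n) :
    ∃ (i : Fin n) (y : Fin (n + 2)), i.val + 1 = x.val ∧ y.val = x.val + 1 ∧
      m = .endm i ∧ q' = .qk y := by
  rcases h with h | ⟨h, rfl⟩
  · simp only [AutoProt, Set.mem_ofPred_eq, Prod.mk.injEq, Act.recv.injEq, reduceCtorEq,
      false_and, and_false, exists_false, or_false, false_or, ASt.qk.injEq] at h
    rcases h with ⟨rfl, -⟩ | ⟨i, rfl, rfl, rfl⟩ | h | ⟨_, h⟩ | ⟨_, _, _, _, h⟩
    · simp at h1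
    · exact ⟨i, _, rfl, rfl, rfl, rfl⟩
    · exact (hq h.2.2).elim
    · exact (hq h.2.2).elim
    · exact (hq h.2.2).elim
  · refine (h ⟨.frown, ?_⟩).elim
    simp only [AutoProt, Set.mem_ofPred_eq]
    exact .inr (.inr (.inr (.inr (.inr (.inr (.inr (.inr (.inr
      (.inl ⟨x, m, h1, h2, rfl⟩)))))))))

theorem receives_qk_last {m : AMsg n A} {x : Fin (n + 2)} {q' : ASt n Qa}
    (h : (AutoProt n Qa δa qa0 qaf).Receives m (.qk x) q') (hx : x.val = n + 1) : q' = .qk x := by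
  rcases h with h | ⟨_, rfl⟩
  · simp only [AutoProt, Set.mem_ofPred_eq, Prod.mk.injEq, Act.recv.injEq, reduceCtorEq,
      false_and, and_false, exists_false, or_false, false_or, ASt.qk.injEq, Fin.ext_iff] at h
    rcases h with h | ⟨i, h, -⟩ | h | ⟨_, h⟩ | ⟨k, _, _, _, h⟩ <;> omega
  · rfl

theorem receives_eSt {m : AMsg n A} {i : Fin n} {q' : ASt n Qa}
    (h : (AutoProt n Qa δa qa0 qaf).Receives m (.eSt i) q') (hq : q' ≠ .frown) :
    (m = .smiley ∧ q' = .auto i (qa0 i)) ∨ ∃ j, i < j ∧ m = .endm j ∧ q' = .eSt i := by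
  rcases h with h | ⟨h, rfl⟩
  · left
    simp only [AutoProt, Set.mem_ofPred_eq, Prod.mk.injEq, Act.recv.injEq, reduceCtorEq,
      false_and, and_false, exists_false, false_or, ASt.eSt.injEq] at h
    rcases h with ⟨j, rfl, rfl, rfl⟩ | ⟨_, _, _, _, h⟩
    · exact ⟨rfl, rfl⟩
    · exact (hq h.2.2).elim
  · right
    by_contra hc
    by_cases hm : m = .smiley
    · subst hm
      refine h ⟨.auto i (qa0 i), ?_⟩
      simp [AutoProt]
    · refine h ⟨.frown, ?_⟩
      simp only [AutoProt, Set.mem_ofPred_eq]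
      iterate 17 right
      refine ⟨i, m, hm, fun j hj => ?_, rfl⟩
      by_contra hij
      exact hc ⟨j, by simpa using hij, hj, rfl⟩

theorem receives_auto {m : AMsg n A} {i : Fin n} {p : Qa i} {q' : ASt n Qa}
    (h : (AutoProt n Qa δa qa0 qaf).Receives m (.auto i p) q') (hq : q' ≠ .frown) :
    (∃ a, m = .letter a ∧ q' = .auto i (δa i p a)) ∨ (m = .dollar ∧ p = qaf i) ∨
    ((∀ a, m ≠ .letter a) ∧ m ≠ .dollar ∧ (∀ j, m ≠ .endm j) ∧ q' = .auto i p) := by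
  rcases h with h | ⟨h, rfl⟩
  · simp only [AutoProt, Set.mem_ofPred_eq, Prod.mk.injEq, Act.recv.injEq, reduceCtorEq,
      false_and, and_false, exists_false, or_false, false_or, hq, ASt.auto.injEq] at h
    rcases h with ⟨j, p', a, ⟨rfl, h⟩, rfl, rfl⟩ | ⟨j, ⟨rfl, h⟩, rfl, rfl⟩
    · obtain rfl := eq_of_heq h
      exact .inl ⟨a, rfl, rfl⟩
    · exact .inr (.inl ⟨rfl, eq_of_heq h⟩)
  · refine .inr (.inr ⟨?_, ?_, ?_, rfl⟩)
    · rintro a rfl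
      refine h ⟨.auto i (δa i p a), ?_⟩
      simp only [AutoProt, Set.mem_ofPred_eq]
      iterate 10 right
      exact .inl ⟨i, p, a, rfl⟩
    · rintro rfl
      refine h ⟨.frown, ?_⟩
      simp only [AutoProt, Set.mem_ofPred_eq]
      iterate 11 right
      exact .inl ⟨i, p, rfl⟩
    · rintro j rfl
      refine h ⟨.frown, ?_⟩
      simp only [AutoProt, Set.mem_ofPred_eq]
      iterate 13 right
      exact .inl ⟨i, p, j, rfl⟩

theorem frown_of_stepAny {C C' : Fin N → ASt n Qa}
    (h : (AutoProt n Qa δa qa0 qaf).StepAny C C') {p : Fin N} (hp : C p = .frown) : C' p = .frown := by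
  obtain ⟨s, m, hs, hr⟩ := h.exists_sender
  rcases eq_or_ne p s with rfl | hps
  · rw [hp] at hs
    exact (not_send_frown hs).elim
  · have := hr p hps
    rw [hp] at this
    exact frown_of_receives this

theorem eq_qin_of_stepAny {C C' : Fin N → ASt n Qa}
    (h : (AutoProt n Qa δa qa0 qaf).StepAny C C') {p : Fin N} (hp : C' p = .qin) : C p = .qin := by
  obtain ⟨s, m, hs, hr⟩ := h.exists_sender
  rcases eq_or_ne p s with rfl | hps
  · rw [hp] at hs
    exact eq_qin_of_send hs
  · have := hr p hps
    rw [hp] at this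
    exact eq_qin_of_receives this

variable (δa qa0 qaf) in
/-- A step in which no process enters the sink or leaves the initial state. -/
structure StableStep (C C' : Fin N → ASt n Qa) : Prop where
  step : (AutoProt n Qa δa qa0 qaf).StepAny C C'
  frown : ∀ p, C' p = .frown → C p = .frown
  qin : ∀ p, C p = .qin → C' p = .qin

variable (δa qa0) in
/-- Every automaton is being simulated by some process, all of them having read the word `w`. -/
def Simulates (C : Fin N → ASt n Qa) (w : List A) : Prop :=
  ∀ i, ∃ p, C p = .auto i (w.foldl (δa i) (qa0 i))

/-- The process `e` has received exactly the messages `end_j` for `j + 1 < x`, whose senders are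
waiting for `☺`. -/
def Collecting (C : Fin N → ASt n Qa) (e : Fin N) : Prop :=
  ∃ x : Fin (n + 2), C e = .qk x ∧ 1 ≤ x.val ∧
    ∀ i : Fin n, i.val + 1 < x.val → ∃ p, C p = .eSt i

theorem StableStep.simulates {C C' : Fin N → ASt n Qa} {w : List A}
    (h : StableStep δa qa0 qaf C C')
    (hw : ¬ ∃ w : List A, ∀ i : Fin n, w.foldl (δa i) (qa0 i) = qaf i)
    (hC : Simulates δa qa0 C w) :
    (∃ w, Simulates δa qa0 C' w) ∧
      ∀ e, C e = .qk 0 → C' e = .qk 0 := by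
  obtain ⟨s, m, hs, hr⟩ := h.step.exists_sender
  choose p hp using hC
  have hfr : ∀ q, C q ≠ .frown → C' q ≠ .frown := fun q hq hq' => hq (h.frown q hq')
  have hsend := send_cases hs (h.qin s)
  have hps : ∀ i, p i ≠ s := by
    rintro i rfl
    rw [hp] at hsend
    simp at hsend
  have hauto := fun i => receives_auto (hp i ▸ hr (p i) (hps i)) (hfr _ (by simp [hp]))
  have hm : m ≠ .dollar := by
    rintro rfl
    exact hw ⟨w, fun i => by simpa using hauto i⟩
  refine ⟨?_, fun e he => ?_⟩
  · by_cases hl : ∃ a, m = .letter a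
    · obtain ⟨a, rfl⟩ := hl
      refine ⟨w ++ [a], fun i => ⟨p i, ?_⟩⟩
      simpa using hauto i
    · refine ⟨w, fun i => ⟨p i, ?_⟩⟩
      have := hauto i
      grind
  · have hes : e ≠ s := by
      rintro rfl
      rw [he] at hsend
      simp [Fin.ext_iff] at hsend
    have := receives_qk_zero (he ▸ hr e hes) (hfr _ (by simp [he]))
    simpa [hm] using this

theorem StableStep.collecting {C C' : Fin N → ASt n Qa} {e : Fin N} (hn : 0 < n)
    (h : StableStep δa qa0 qaf C C') (hC : Collecting C e) :
    Collecting C' e ∨ Simulates δa qa0 C' [] := by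
  obtain ⟨s, m, hs, hr⟩ := h.step.exists_sender
  obtain ⟨x, hx, h1, hE⟩ := hC
  have hfr : ∀ q, C q ≠ .frown → C' q ≠ .frown := fun q hq hq' => hq (h.frown q hq')
  have hsend := send_cases hs (h.qin s)
  have heSt : ∀ i p, C p = .eSt i →
      (m = .smiley ∧ C' p = .auto i (qa0 i)) ∨ ∃ j, i < j ∧ m = .endm j ∧ C' p = .eSt i := by
    intro i p hp
    have hps : p ≠ s := by
      rintro rfl
      rw [hp] at hsend
      simp at hsend
    exact receives_eSt (hp ▸ hr p hps) (hfr _ (by simp [hp]))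
  by_cases hxn : x.val ≤ n
  · left
    have hes : e ≠ s := by
      rintro rfl
      rw [hx] at hsend
      simp [Fin.ext_iff] at hsend
      omega
    obtain ⟨i, y, hi, hy, rfl, hey⟩ :=
      receives_qk_mid (hx ▸ hr e hes) (hfr _ (by simp [hx])) h1 hxn
    refine ⟨y, hey, by omega, fun j hj => ?_⟩
    by_cases hji : j = i
    · subst hji
      refine ⟨s, ?_⟩
      rcases hsend with ⟨_, hm⟩ | ⟨_, hm, _⟩ | ⟨k, _, hm, hk⟩
      · simp at hm
      · simp at hm
      · simp at hm
        subst hm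
        exact hk
    · obtain ⟨p, hp⟩ := hE j (by have := Fin.val_ne_of_ne hji; omega)
      refine ⟨p, ?_⟩
      have := heSt j p hp
      grind
  · right
    have hm : m = .smiley := by
      obtain ⟨p, hp⟩ := hE ⟨n - 1, by omega⟩ (by simp only; omega)
      rcases heSt _ p hp with h | ⟨j, hj, _⟩
      · exact h.1
      · rw [Fin.lt_def] at hj
        simp only at hj
        omega
    subst hm
    intro i
    obtain ⟨p, hp⟩ := hE i (by omega)
    exact ⟨p, by simpa using heSt i p hp⟩

theorem StableStep.qk_zero {C C' : Fin N → ASt n Qa} {e : Fin N}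
    (h : StableStep δa qa0 qaf C C') (he : C e = .qk 0) :
    C' e = .qk 0 ∨ Collecting C' e := by
  obtain ⟨s, m, hs, hr⟩ := h.step.exists_sender
  have hsend := send_cases hs (h.qin s)
  have hes : e ≠ s := by
    rintro rfl
    rw [he] at hsend
    simp [Fin.ext_iff] at hsend
  rcases receives_qk_zero (he ▸ hr e hes) (fun hf => by simp [h.frown e hf] at he) with h | h
  · exact .inr ⟨1, h.2, by simp, fun i hi => by simp at hi⟩
  · exact .inl h.2

end AutoProt

open AutoProt
/-- **From repeated coverability to a common word.** If the associated protocol has an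
infinite execution in which one process takes the transition `t_f = (q_{n+2}, !!☺, q_1)`
infinitely often, then the intersection of the languages of the `A_i` is nonempty. -/
theorem repeated_coverability_to_word {A : Type} [Fintype A] {n : ℕ}
    (Qa : Fin n → Type) [∀ i, Fintype (Qa i)]
    (δa : ∀ i, Qa i → A → Qa i) (qa0 qaf : ∀ i, Qa i)
    (h : ∃ (N : ℕ) (ρ : Exec (AutoProt n Qa δa qa0 qaf) N), ρ.len = ⊤ ∧
      ∃ e : Fin N, ∀ i : ℕ, ∃ j : ℕ, i < j ∧
        (AutoProt n Qa δa qa0 qaf).Step e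
          (ASt.qk ⟨n + 1, by omega⟩, Act.send AMsg.smiley, ASt.qk ⟨0, by omega⟩)
          (ρ.conf j) (ρ.conf (j + 1))) :
    ∃ w : List A, ∀ i : Fin n, w.foldl (δa i) (qa0 i) = qaf i := by
  by_contra hw
  have hn : 0 < n := by
    rcases Nat.eq_zero_or_pos n with rfl | hn
    · exact (hw ⟨[], fun i => i.elim0⟩).elim
    · exact hn
  obtain ⟨N, ρ, hlen, e, he⟩ := h
  have hstep : ∀ s, (AutoProt n Qa δa qa0 qaf).StepAny (ρ.conf s) (ρ.conf (s + 1)) :=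
    fun s => ρ.step s (by rw [hlen]; exact_mod_cast ENat.natCast_lt_top (s + 1))
  obtain ⟨t₁, ht₁⟩ := exists_forall_ge_of_succ_imp (fun p s => ρ.conf s p = .frown)
    (fun _ s hp => frown_of_stepAny (hstep s) hp)
  obtain ⟨t₂, ht₂⟩ := exists_forall_ge_of_succ_imp (fun p s => ρ.conf s p ≠ .qin)
    (fun _ s hp hp' => hp (eq_qin_of_stepAny (hstep s) hp'))
  have hstable : ∀ s, max t₁ t₂ ≤ s →
      StableStep δa qa0 qaf (ρ.conf s) (ρ.conf (s + 1)) := fun s hs =>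
    ⟨hstep s, ht₁ s (le_trans (le_max_left _ _) hs), fun p hp => by
      by_contra hp'
      exact ht₂ s (le_trans (le_max_right _ _) hs) p hp' hp⟩
  have hround : ∀ i, ∃ j, i < j ∧ ρ.conf j e = .qk (Fin.last (n + 1)) ∧
      ρ.conf (j + 1) e = .qk 0 := by
    intro i
    obtain ⟨j, hij, q, a, q', ht, -, hq, hq', -⟩ := he i
    simp only [Prod.mk.injEq] at ht
    obtain ⟨rfl, -, rfl⟩ := ht
    exact ⟨j, hij, hq, hq'⟩
  obtain ⟨j₁, hj₁, -, hz₁⟩ := hround (max t₁ t₂)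
  have hphase : ∀ s, j₁ + 1 ≤ s → ρ.conf s e = .qk 0 ∨ Collecting (ρ.conf s) e ∨
      ∃ w, Simulates δa qa0 (ρ.conf s) w := by
    intro s hs
    induction s, hs using Nat.le_induction with
    | base => exact .inl hz₁
    | succ s hs ih =>
      have hst := hstable s (by omega)
      rcases ih with h | h | ⟨w, h⟩
      · rcases hst.qk_zero h with h | h
        · exact .inl h
        · exact .inr (.inl h)
      · rcases hst.collecting hn h with h | h
        · exact .inr (.inl h)
        · exact .inr (.inr ⟨[], h⟩)
      · exact .inr (.inr (hst.simulates hw h).1)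
  obtain ⟨j₂, hj₂, hl₂, hz₂⟩ := hround (j₁ + 1)
  have hsim₂ : ∃ w, Simulates δa qa0 (ρ.conf (j₂ + 1)) w := by
    rcases hphase j₂ hj₂.le with h | h | ⟨w, h⟩
    · simp [hl₂, Fin.ext_iff] at h
    · rcases (hstable j₂ (by omega)).collecting hn h with ⟨x, hx, hx1, -⟩ | h
      · rw [hz₂, ASt.qk.injEq] at hx
        simp [← hx] at hx1
      · exact ⟨[], h⟩
    · exact ((hstable j₂ (by omega)).simulates hw h).1
  have hstuck : ∀ s, j₂ + 1 ≤ s → ρ.conf s e = .qk 0 ∧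
      ∃ w, Simulates δa qa0 (ρ.conf s) w := by
    intro s hs
    induction s, hs using Nat.le_induction with
    | base => exact ⟨hz₂, hsim₂⟩
    | succ s hs ih =>
      obtain ⟨h, w, hS⟩ := ih
      have := (hstable s (by omega)).simulates hw hS
      exact ⟨this.2 e h, this.1⟩
  obtain ⟨j₃, hj₃, hl₃, -⟩ := hround (j₂ + 1)
  have := (hstuck j₃ hj₃.le).1
  rw [hl₃] at this
  simp [Fin.ext_iff] at this
end

section
/- Let P be a Wait-Only protocol with uncoverable state q_u, let t_f = (q, !!a, q') ∈ T be a broadcast transition, and let V_P^☺ be the associated tagged VASS. Then there exist an infinite execution ρ of P and a process e ∈ [1, nb(ρ)] such that for all i ∈ N there exists j > i with ρ_j →^{e, t_f} ρ_{j+1}, if and only if V_P^☺ has an infinite run starting in (s_0, 0) that visits locations of the form (SS, ☺) infinitely often. -/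
set_option maxHeartbeats 1000000

/-- A summary: a print (set of waiting states), an exit state and an identifier. -/
structure Summary (Q : Type) where
  pr : Set Q
  exit : Q
  id : ℕ

namespace BP

variable {Q M : Type}

/-- `|Q_W|`. -/
noncomputable def nW (P : Protocol Q M) : ℕ := P.QW.ncard

def ValidSummary (P : Protocol Q M) (S : Summary Q) : Prop :=
  S.pr ⊆ P.QW ∧ S.exit ∈ P.QA ∧ 1 ≤ S.id ∧ S.id ≤ nW P + 1

/-- Coherent sets of summaries. -/
def Coherent (P : Protocol Q M) (SS : Set (Summary Q)) : Prop :=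
  (∀ S ∈ SS, ValidSummary P S) ∧
  ∀ S1 ∈ SS, ∀ S2 ∈ SS, S1 ≠ S2 → S1.exit = S2.exit →
    S1.id ≠ S2.id ∧ S1.pr ∩ S2.pr = ∅

/-- Labels of a set of summaries. -/
def labs (SS : Set (Summary Q)) : Set (Q × ℕ) := (fun S => (S.exit, S.id)) '' SS

/-- `σ` describes a legal reaction of each state of `pr` to the broadcast of `b`. -/
def RecvFun (P : Protocol Q M) (b : M) (pr : Set Q) (σ : Q → Q) : Prop :=
  ∀ p ∈ pr, (p, Act.recv b, σ p) ∈ P.T ∨ (b ∉ P.R p ∧ σ p = p)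

/-- `S ⟶^t S'`. -/
def SummStep (P : Protocol Q M) (t : Q × Act M × Q) (S S' : Summary Q) : Prop :=
  ∃ q b q', t = (q, Act.send b, q') ∧ t ∈ P.T ∧
    ∃ σ : Q → Q, RecvFun P b S.pr σ ∧ S'.exit = S.exit ∧ S'.id = S.id ∧
      S'.pr = σ '' S.pr ∧ σ '' S.pr ⊆ P.QW

/-- `S ⟶^{t,+q'} S'`. -/
def SummStepJoin (P : Protocol Q M) (t : Q × Act M × Q) (S S' : Summary Q) : Prop :=
  ∃ q b q', t = (q, Act.send b, q') ∧ t ∈ P.T ∧ q' ∈ P.QW ∧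
    ∃ σ : Q → Q, RecvFun P b S.pr σ ∧ S'.exit = S.exit ∧ S'.id = S.id ∧
      S'.pr = σ '' S.pr ∪ {q'} ∧ σ '' S.pr ∪ {q'} ⊆ P.QW

/-- `S ⟶^t Done`. -/
def SummStepDone (P : Protocol Q M) (t : Q × Act M × Q) (S : Summary Q) : Prop :=
  ∃ q b q', t = (q, Act.send b, q') ∧ t ∈ P.T ∧
    ∃ σ : Q → Q, RecvFun P b S.pr σ ∧ σ '' S.pr = {S.exit}

/-- `S` steps to `some S'` or to `Done` (encoded as `none`). -/
def stepsTo (P : Protocol Q M) (t : Q × Act M × Q) (S : Summary Q) :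
    Option (Summary Q) → Prop
  | some S' => SummStep P t S S'
  | none => SummStepDone P t S

inductive CtrBase (Q : Type) where
  | st : Q → CtrBase Q
  | sm : Q → ℕ → CtrBase Q

def ValidCtr (P : Protocol Q M) : CtrBase Q → Prop
  | .st q => q ∈ P.QA
  | .sm q k => q ∈ P.QA ∧ 1 ≤ k ∧ k ≤ nW P + 1

/-- The counters of the VASS built from `P`. -/
abbrev Ctr (P : Protocol Q M) := {x : CtrBase Q // ValidCtr P x}

open Classical in
/-- Characteristic (unit) vector of a counter. -/
noncomputable def chi (P : Protocol Q M) (x : CtrBase Q) : Ctr P → ℤ :=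
  fun y => if y.val = x then 1 else 0

/-- The relation `(SS, δ, SS') ∈ Δ_t`. -/
def DeltaT (P : Protocol Q M) (t : Q × Act M × Q) (SS : Set (Summary Q))
    (δ : Ctr P → ℤ) (SS' : Set (Summary Q)) : Prop :=
  Coherent P SS ∧ Coherent P SS' ∧
  ∃ q a q', t = (q, Act.send a, q') ∧ t ∈ P.T ∧
  ((q' ∈ P.QA ∧
      (∃ g : Summary Q → Option (Summary Q),
        (∀ S ∈ SS, stepsTo P t S (g S)) ∧
        SS' = {S' | ∃ S ∈ SS, g S = some S'}) ∧
      δ = fun y => chi P (.st q') y - chi P (.st q) y) ∨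
   (q' ∈ P.QW ∧
      ∃ S0 ∈ SS, ∃ S0' : Summary Q, SummStepJoin P t S0 S0' ∧
      (∃ g : Summary Q → Option (Summary Q),
        (∀ S ∈ SS, S ≠ S0 → stepsTo P t S (g S)) ∧
        SS' = insert S0' {S' | ∃ S ∈ SS, S ≠ S0 ∧ g S = some S'}) ∧
      δ = fun y => chi P (.sm S0.exit S0.id) y - chi P (.st q) y) ∨
   (q' ∈ P.QW ∧
      ∃ qa ∈ P.QA, ∃ k : ℕ, 1 ≤ k ∧ k ≤ nW P + 1 ∧ (qa, k) ∉ labs SS ∧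
      (∃ g : Summary Q → Option (Summary Q),
        (∀ S ∈ SS, stepsTo P t S (g S)) ∧
        SS' = insert (Summary.mk {q'} qa k) {S' | ∃ S ∈ SS, g S = some S'}) ∧
      δ = fun y => chi P (.sm qa k) y - chi P (.st q) y))

/-- The relation `(SS, δ, SS) ∈ Δ_e`. -/
def DeltaE (P : Protocol Q M) (SS : Set (Summary Q)) (δ : Ctr P → ℤ) : Prop :=
  Coherent P SS ∧ ∃ q ∈ P.QA, ∃ k : ℕ, 1 ≤ k ∧ k ≤ nW P + 1 ∧ (q, k) ∉ labs SS ∧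
    δ = fun y => chi P (.st q) y - chi P (.sm q k) y

/-- Locations of the VASS `V_P` (final state a waiting state). -/
inductive LocW (Q : Type) where
  | s0 : LocW Q
  | sf : LocW Q
  | co : Set (Summary Q) → LocW Q

/-- The VASS `V_P` associated to `P`, `q_u`, and a final waiting state `q_f`. -/
noncomputable def VP (P : Protocol Q M) (qu qf : Q) : VASS (LocW Q) (Ctr P) where
  init := .s0
  Δ := {d |
    d = (.s0, chi P (.st P.qin), .s0) ∨
    d = (.s0, 0, .co ∅) ∨
    d = (LocW.co {Summary.mk {qf} qu 1}, 0, .sf) ∨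
    d = (.sf, fun y => -(chi P (.sm qu 1) y), .sf) ∨
    (∃ t SS δ SS', d = (.co SS, δ, .co SS') ∧ DeltaT P t SS δ SS') ∨
    (∃ SS δ, d = (.co SS, δ, .co SS) ∧ DeltaE P SS δ)}

/-- `C ∈ ⟦(SS, v)⟧`. -/
def Implements (P : Protocol Q M) (SS : Set (Summary Q)) (v : Ctr P → ℕ)
    {n : ℕ} (C : Fin n → Q) : Prop :=
  ∃ f : Fin n → Ctr P,
    (∀ x : Ctr P, {e : Fin n | f e = x}.ncard = v x) ∧
    (∀ e q, (f e).val = CtrBase.st q → C e = q) ∧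
    (∀ e q k pr, (f e).val = CtrBase.sm q k → Summary.mk pr q k ∈ SS → C e ∈ pr ∪ {q}) ∧
    (∀ e q k, (f e).val = CtrBase.sm q k → (q, k) ∉ labs SS → C e = q)

end BP


namespace BP

variable {Q M : Type}

/-- Locations of the tagged VASS `V_P^☺`. -/
inductive LocS (Q : Type) where
  | s0 : LocS Q
  | co : Set (Summary Q) → LocS Q
  | coS : Set (Summary Q) → LocS Q

/-- The tagged VASS `V_P^☺` associated to `P` and a broadcast transition `t_f`. -/
noncomputable def VPS (P : Protocol Q M) (tf : Q × Act M × Q) : VASS (LocS Q) (Ctr P) where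
  init := .s0
  Δ := {d |
    d = (.s0, chi P (.st P.qin), .s0) ∨
    d = (.s0, 0, .co ∅) ∨
    (∃ t SS δ SS', t ≠ tf ∧ d = (.co SS, δ, .co SS') ∧ DeltaT P t SS δ SS') ∨
    (∃ SS δ SS', d = (.co SS, δ, .coS SS') ∧ DeltaT P tf SS δ SS') ∨
    (∃ SS, d = (.coS SS, 0, .co SS)) ∨
    (∃ SS δ, d = (.co SS, δ, .co SS) ∧ DeltaE P SS δ)}

end BP

/-! ### Infinite runs of relations -/

section Runs

variable {α : Type*}

open Relation

theorem exists_path_of_transGen {r : α → α → Prop} {a b : α} (h : TransGen r a b) :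
    ∃ (L : ℕ) (g : ℕ → α), g 0 = a ∧ g (L + 1) = b ∧ ∀ j ≤ L, r (g j) (g (j + 1)) := by
  induction h with
  | @single b h =>
    refine ⟨0, fun j => if j = 0 then a else b, by simp, by simp, ?_⟩
    intro j hj
    obtain rfl : j = 0 := by omega
    simpa using h
  | @tail b c _ h ih =>
    obtain ⟨L, g, h0, h1, h2⟩ := ih
    refine ⟨L + 1, fun j => if j ≤ L + 1 then g j else c, by simp [h0], by simp, ?_⟩
    intro j hj
    rcases Nat.lt_or_ge j (L + 1) with hlt | hge
    · have h3 : j + 1 ≤ L + 1 := hlt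
      simpa [hj, h3] using h2 j (by omega)
    · obtain rfl : j = L + 1 := by omega
      simpa [h1] using h

/-- Concatenation of infinitely many nonempty paths. -/
theorem exists_run_of_transGen {r : α → α → Prop} (D : ℕ → α)
    (h : ∀ k, TransGen r (D k) (D (k + 1))) :
    ∃ c : ℕ → α, c 0 = D 0 ∧ (∀ i, r (c i) (c (i + 1))) ∧ ∀ k, ∃ j, k ≤ j ∧ c j = D k := by
  choose L g h0 h1 h2 using fun k => exists_path_of_transGen (h k)
  let nxt : ℕ × ℕ → ℕ × ℕ := fun x => if x.2 < L x.1 then (x.1, x.2 + 1) else (x.1 + 1, 0)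
  let st : ℕ → ℕ × ℕ := fun i => nxt^[i] (0, 0)
  have st_succ : ∀ i, st (i + 1) = nxt (st i) := fun i => Function.iterate_succ_apply' _ _ _
  have hle : ∀ i, (st i).2 ≤ L (st i).1 := by
    intro i
    induction i with
    | zero => simp [st]
    | succ i ih =>
      rw [st_succ]
      by_cases hc : (st i).2 < L (st i).1
      · simp only [nxt, hc, if_true]; omega
      · simp [nxt, hc]
  have visit : ∀ k, ∃ j, k ≤ j ∧ st j = (k, 0) := by
    intro k
    induction k with
    | zero => exact ⟨0, le_rfl, rfl⟩
    | succ k ih =>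
      obtain ⟨j, hj, hst⟩ := ih
      have walk : ∀ m ≤ L k, st (j + m) = (k, m) := by
        intro m
        induction m with
        | zero => intro _; simpa using hst
        | succ m ihm =>
          intro hm
          rw [← add_assoc, st_succ, ihm (by omega)]
          simp only [nxt]
          rw [if_pos (by omega)]
      refine ⟨j + L k + 1, by omega, ?_⟩
      rw [st_succ, walk _ le_rfl]
      simp [nxt]
  refine ⟨fun i => g (st i).1 (st i).2, by simp [st, h0], ?_, ?_⟩
  · intro i
    have hi := h2 _ _ (hle i)
    simp only [st_succ]
    by_cases hc : (st i).2 < L (st i).1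
    · simpa [nxt, hc] using hi
    · have he : (st i).2 = L (st i).1 := le_antisymm (hle i) (not_lt.mp hc)
      simp only [nxt, hc, if_false, h0]
      rw [← h1, ← he]
      exact hi
  · intro k
    obtain ⟨j, hj, hst⟩ := visit k
    exact ⟨j, hj, by simp [hst, h0]⟩

/-- From an infinite sequence of possibly empty paths, infinitely many of which contain an
`s`-edge, extract an infinite run taking infinitely many `s`-edges. -/
theorem exists_run_of_reflTransGen {r s : α → α → Prop} (hsr : ∀ x y, s x y → r x y) (D : ℕ → α)
    (hD : ∀ i, ReflTransGen r (D i) (D (i + 1)))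
    (hinf : ∀ i, ∃ j, i < j ∧ ∃ x y, ReflTransGen r (D j) x ∧ s x y ∧
      ReflTransGen r y (D (j + 1))) :
    ∃ c : ℕ → α, c 0 = D 0 ∧ (∀ i, r (c i) (c (i + 1))) ∧
      ∀ i, ∃ j, i < j ∧ s (c j) (c (j + 1)) := by
  choose J hJ X Y hX hs hY using hinf
  let r' : α × Bool → α × Bool → Prop := fun x y => r x.1 y.1 ∧ (y.2 = true → s x.1 y.1)
  have lift : ∀ {x y}, ReflTransGen r x y → ∀ β, ∃ β', ReflTransGen r' (x, β) (y, β') := by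
    intro x y hxy β
    induction hxy with
    | refl => exact ⟨β, .refl⟩
    | tail _ h ih =>
      obtain ⟨β', h'⟩ := ih
      exact ⟨false, h'.tail ⟨h, by simp⟩⟩
  have hmono : ∀ i j, i ≤ j → ReflTransGen r (D i) (D j) := by
    intro i j hij
    induction j, hij using Nat.le_induction with
    | base => exact .refl
    | succ j _ ih => exact ih.trans (hD j)
  have mk : ∀ x i β, ReflTransGen r x (D (J i)) → TransGen r' (x, β) (Y i, true) := by
    intro x i β h
    obtain ⟨β', h'⟩ := lift (h.trans (hX i)) β
    exact TransGen.tail' h' ⟨hsr _ _ (hs i), fun _ => hs i⟩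
  let ψ : ℕ → ℕ := fun k => J^[k] 0
  have ψ_succ : ∀ k, ψ (k + 1) = J (ψ k) := fun k => Function.iterate_succ_apply' _ _ _
  let E : ℕ → α × Bool := fun k => k.casesOn (D 0, false) fun k => (Y (ψ k), true)
  have hE : ∀ k, TransGen r' (E k) (E (k + 1)) := by
    intro k
    cases k with
    | zero => exact mk _ _ _ (hmono _ _ (Nat.zero_le _))
    | succ k =>
      refine mk _ _ _ ((hY (ψ k)).trans (hmono _ _ ?_))
      rw [← ψ_succ]
      exact hJ _
  obtain ⟨c, h0, h1, h2⟩ := exists_run_of_transGen E hE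
  refine ⟨fun i => (c i).1, by simp [h0, E], fun i => (h1 i).1, ?_⟩
  intro i
  obtain ⟨j, hj, hcj⟩ := h2 (i + 2)
  obtain ⟨j, rfl⟩ : ∃ j', j = j' + 1 := ⟨j - 1, by omega⟩
  exact ⟨j, by omega, (h1 j).2 (by rw [hcj])⟩

/-- Dependent choice along an indexed invariant. -/
theorem exists_seq_of_invariant {R : ℕ → α → α → Prop} (I : ℕ → α → Prop) {x₀ : α} (h0 : I 0 x₀)
    (h : ∀ i x, I i x → ∃ y, I (i + 1) y ∧ R i x y) :
    ∃ f : ℕ → α, f 0 = x₀ ∧ ∀ i, I i (f i) ∧ R i (f i) (f (i + 1)) := by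
  choose F hF using h
  let g : ∀ i : ℕ, {x // I i x} := fun i =>
    Nat.rec ⟨x₀, h0⟩ (fun i x => ⟨F i x.1 x.2, (hF i x.1 x.2).1⟩) i
  exact ⟨fun i => (g i).1, rfl, fun i => ⟨(g i).2, (hF i (g i).1 (g i).2).2⟩⟩

end Runs

/-! ### Counting -/

section Count

variable {β : Type*} {n : ℕ}

open Classical in
/-- Number of indices mapped to `x`. -/
noncomputable def countFiber (f : Fin n → β) (x : β) : ℕ := ∑ e, if f e = x then 1 else 0

open Classical in
theorem countFiber_update (f : Fin n → β) (e : Fin n) (y x : β) :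
    (countFiber (Function.update f e y) x : ℤ) =
      countFiber f x + ((if x = y then 1 else 0) - (if x = f e then 1 else 0)) := by
  have h : ∑ i ∈ Finset.univ.erase e, (if Function.update f e y i = x then (1 : ℤ) else 0) =
      ∑ i ∈ Finset.univ.erase e, (if f i = x then (1 : ℤ) else 0) :=
    Finset.sum_congr rfl fun i hi => by
      rw [Function.update_of_ne (Finset.ne_of_mem_erase hi)]
  unfold countFiber
  push_cast
  rw [← Finset.add_sum_erase _ _ (Finset.mem_univ e),
    ← Finset.add_sum_erase (a := e) _ (fun i => if f i = x then (1 : ℤ) else 0)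
      (Finset.mem_univ e), h]
  simp only [Function.update_self, eq_comm (a := x)]
  ring

theorem exists_of_countFiber_pos {f : Fin n → β} {x : β} (h : 0 < countFiber f x) :
    ∃ e, f e = x := by
  by_contra! hc
  simp [countFiber, hc] at h

end Count

namespace BP

variable {Q M : Type} {P : Protocol Q M} {n : ℕ}

/-- A process in state `s` may move to `s'` when another process broadcasts `b`. -/
def Legal (P : Protocol Q M) (b : M) (s s' : Q) : Prop :=
  (s, Act.recv b, s') ∈ P.T ∨ (b ∉ P.R s ∧ s' = s)

theorem legal_self_of_action {b : M} {s : Q} (h : ¬ P.isWaiting s) : Legal P b s s :=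
  Or.inr ⟨fun ⟨q', hq'⟩ => h ⟨b, q', hq'⟩, rfl⟩

theorem Legal.eq_of_action {b : M} {s s' : Q} (hl : Legal P b s s') (h : ¬ P.isWaiting s) :
    s' = s :=
  hl.elim (fun hr => (h ⟨b, s', hr⟩).elim) And.right

theorem not_isWaiting_of_send (hWO : P.WaitOnly) {q q' : Q} {a : M}
    (h : (q, Act.send a, q') ∈ P.T) : ¬ P.isWaiting q :=
  (hWO.1 q).elim id fun hn => (hn ⟨a, q', h⟩).elim

open Classical in
theorem chi_apply (x y : Ctr P) : chi P x.val y = if y = x then 1 else 0 := by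
  simp [chi, Subtype.ext_iff]

open Classical in
theorem countFiber_update_ctr (f : Fin n → Ctr P) (e : Fin n) (y x : Ctr P) :
    (countFiber (Function.update f e y) x : ℤ) =
      countFiber f x + (chi P y.val x - chi P (f e).val x) := by
  rw [countFiber_update, chi_apply, chi_apply]
  congr!

theorem exists_countFiber_move {f : Fin n → Ctr P} {v' : Ctr P → ℕ} {y z : Ctr P} (hne : y ≠ z)
    (h : ∀ x, (v' x : ℤ) = countFiber f x + (chi P y.val x - chi P z.val x)) :
    ∃ e, f e = z ∧ ∀ x, countFiber (Function.update f e y) x = v' x := by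
  classical
  have hz : 0 < countFiber f z := by
    have := h z
    rw [chi_apply, chi_apply, if_neg hne.symm, if_pos rfl] at this
    omega
  obtain ⟨e, he⟩ := exists_of_countFiber_pos hz
  refine ⟨e, he, fun x => ?_⟩
  have h1 := countFiber_update_ctr f e y x
  rw [he, ← h x] at h1
  exact_mod_cast h1

/-- The configuration `C` is described by `(SS, v)`, where `f` gives the counter of each
process. -/
structure Describes (SS : Set (Summary Q)) (v : Ctr P → ℕ) (f : Fin n → Ctr P)
    (C : Fin n → Q) : Prop where
  count : ∀ x, countFiber f x = v x
  eq_st : ∀ e q, (f e).val = .st q → C e = q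
  mem_sm : ∀ e q k, (f e).val = .sm q k → C e = q ∨ ∃ pr, Summary.mk pr q k ∈ SS ∧ C e ∈ pr

theorem stepsTo.exists_legal {q q' : Q} {a : M} {S : Summary Q} {o : Option (Summary Q)}
    (h : stepsTo P (q, Act.send a, q') S o) {s : Q} (hs : s ∈ S.pr) :
    ∃ s', Legal P a s s' ∧ (s' = S.exit ∨
      ∃ pr, o = some (Summary.mk pr S.exit S.id) ∧ s' ∈ pr) := by
  cases o with
  | none =>
    obtain ⟨_, _, _, ht, -, σ, hσ, him⟩ := h
    cases ht
    refine ⟨σ s, hσ s hs, Or.inl ?_⟩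
    have : σ s ∈ σ '' S.pr := ⟨s, hs, rfl⟩
    simpa [him] using this
  | some S' =>
    obtain ⟨_, _, _, ht, -, σ, hσ, h1, h2, h3, -⟩ := h
    cases ht
    refine ⟨σ s, hσ s hs, Or.inr ⟨S'.pr, by rw [← h1, ← h2], ?_⟩⟩
    rw [h3]
    exact ⟨s, hs, rfl⟩

theorem Describes.broadcast (hWO : P.WaitOnly) {SS SS' : Set (Summary Q)} {v v' : Ctr P → ℕ}
    {f : Fin n → Ctr P} {C : Fin n → Q} (hd : Describes SS v f C) {q q' : Q} {a : M}
    (ht : (q, Act.send a, q') ∈ P.T)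
    (hrecv : ∀ S ∈ SS, ∀ s ∈ S.pr, ∃ s', Legal P a s s' ∧
      (s' = S.exit ∨ ∃ pr, Summary.mk pr S.exit S.id ∈ SS' ∧ s' ∈ pr))
    (y : Ctr P) (hst : ∀ r, y.val = .st r → q' = r)
    (hsm : ∀ r k, y.val = .sm r k → ∃ pr, Summary.mk pr r k ∈ SS' ∧ q' ∈ pr)
    (hv : ∀ x, (v' x : ℤ) = v x + (chi P y.val x - chi P (.st q) x)) :
    ∃ f' C', Describes SS' v' f' C' ∧ ∃ e : Fin n, P.Step e (q, Act.send a, q') C C' := by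
  classical
  have hq := not_isWaiting_of_send hWO ht
  let z : Ctr P := ⟨.st q, hq⟩
  have hne : y ≠ z := by
    rintro rfl
    obtain rfl := hst q rfl
    exact hWO.2.2 _ _ ht
  obtain ⟨e, he, hcnt⟩ := exists_countFiber_move (f := f) (v' := v') hne (fun x => by
    rw [hd.count]; exact hv x)
  have hmove : ∀ e', ∃ s', Legal P a (C e') s' ∧
      (∀ r, (f e').val = .st r → s' = r) ∧
      (∀ r k, (f e').val = .sm r k → s' = r ∨ ∃ pr, Summary.mk pr r k ∈ SS' ∧ s' ∈ pr) := by
    intro e'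
    rcases hfe : f e' with ⟨x, hx⟩
    cases x with
    | st r =>
      obtain rfl := hd.eq_st e' r (by rw [hfe])
      exact ⟨_, legal_self_of_action hx, by simp, by simp⟩
    | sm r k =>
      rcases hd.mem_sm e' r k (by rw [hfe]) with rfl | ⟨pr, hS, hpr⟩
      · exact ⟨_, legal_self_of_action hx.1, by simp, by simp +contextual⟩
      · obtain ⟨s', h1, h2⟩ := hrecv _ hS _ hpr
        refine ⟨s', h1, by simp, ?_⟩
        rintro r' k' ⟨⟩
        exact h2
  choose s' hs1 hs2 hs3 using hmove
  refine ⟨Function.update f e y, Function.update s' e q', ⟨hcnt, ?_, ?_⟩, e, q, a, q', rfl, ht,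
    hd.eq_st e q (by rw [he]), by simp, ?_⟩
  · intro e' r
    by_cases hee : e' = e
    · subst hee; simpa using hst r
    · simpa [hee] using hs2 e' r
  · intro e' r k
    by_cases hee : e' = e
    · subst hee; simpa using fun h => Or.inr (hsm r k h)
    · simpa [hee] using hs3 e' r k
  · intro e' hee
    rw [Function.update_of_ne hee]
    exact hs1 e'

theorem Describes.deltaT (hWO : P.WaitOnly) {t : Q × Act M × Q} {SS SS' : Set (Summary Q)}
    {δ : Ctr P → ℤ} (h : DeltaT P t SS δ SS') {v v' : Ctr P → ℕ}
    {f : Fin n → Ctr P} {C : Fin n → Q} (hd : Describes SS v f C)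
    (hv : ∀ x, (v' x : ℤ) = v x + δ x) :
    ∃ f' C', Describes SS' v' f' C' ∧ ∃ e : Fin n, P.Step e t C C' := by
  obtain ⟨hco, -, q, a, q', rfl, ht, ⟨hq', ⟨g, hg, rfl⟩, rfl⟩ |
    ⟨hq', S0, hS0, S0', hj, ⟨g, hg, rfl⟩, rfl⟩ |
    ⟨hq', qa, hqa, k, hk1, hk2, hlab, ⟨g, hg, rfl⟩, rfl⟩⟩ := h
  · refine hd.broadcast hWO ht ?_ ⟨.st q', hq'⟩ (by simp) (by simp) hv
    intro S hS s hs
    obtain ⟨s', h1, h2 | ⟨pr, h2, h3⟩⟩ := (hg S hS).exists_legal hs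
    · exact ⟨s', h1, Or.inl h2⟩
    · exact ⟨s', h1, Or.inr ⟨pr, ⟨S, hS, h2⟩, h3⟩⟩
  · obtain ⟨_, _, _, ht', -, -, σ, hσ, h1, h2, h3, -⟩ := hj
    cases ht'
    have hmk : Summary.mk S0'.pr S0.exit S0.id = S0' := by rw [← h1, ← h2]
    refine hd.broadcast hWO ht ?_ ⟨.sm S0.exit S0.id, (hco.1 S0 hS0).2⟩ (by simp) ?_ hv
    · intro S hS s hs
      by_cases hSS : S = S0
      · subst hSS
        refine ⟨σ s, hσ s hs, Or.inr ⟨S0'.pr, Or.inl hmk, ?_⟩⟩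
        rw [h3]
        exact Or.inl ⟨s, hs, rfl⟩
      · obtain ⟨s', h1, h2 | ⟨pr, h2, h3⟩⟩ := (hg S hS hSS).exists_legal hs
        · exact ⟨s', h1, Or.inl h2⟩
        · exact ⟨s', h1, Or.inr ⟨pr, Or.inr ⟨S, hS, hSS, h2⟩, h3⟩⟩
    · rintro r k ⟨⟩
      exact ⟨S0'.pr, Or.inl hmk, by rw [h3]; exact Or.inr rfl⟩
  · refine hd.broadcast hWO ht ?_ ⟨.sm qa k, hqa, hk1, hk2⟩ (by simp) ?_ hv
    · intro S hS s hs
      obtain ⟨s', h1, h2 | ⟨pr, h2, h3⟩⟩ := (hg S hS).exists_legal hs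
      · exact ⟨s', h1, Or.inl h2⟩
      · exact ⟨s', h1, Or.inr ⟨pr, Or.inr ⟨S, hS, h2⟩, h3⟩⟩
    · rintro r k' ⟨⟩
      exact ⟨{q'}, Or.inl rfl, rfl⟩

theorem Describes.deltaE {SS : Set (Summary Q)}
    {δ : Ctr P → ℤ} (h : DeltaE P SS δ) {v v' : Ctr P → ℕ}
    {f : Fin n → Ctr P} {C : Fin n → Q} (hd : Describes SS v f C)
    (hv : ∀ x, (v' x : ℤ) = v x + δ x) :
    ∃ f', Describes SS v' f' C := by
  classical
  obtain ⟨-, q, hq, k, hk1, hk2, hlab, rfl⟩ := h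
  have hne : (⟨.st q, hq⟩ : Ctr P) ≠ ⟨.sm q k, hq, hk1, hk2⟩ := fun h => by
    simpa using congrArg Subtype.val h
  obtain ⟨e, he, hcnt⟩ := exists_countFiber_move (f := f) (v' := v') hne (fun x => by
    rw [hd.count]; exact hv x)
  have hCe : C e = q := by
    rcases hd.mem_sm e q k (by rw [he]) with h | ⟨pr, hS, -⟩
    · exact h
    · exact (hlab ⟨_, hS, rfl⟩).elim
  refine ⟨_, hcnt, ?_, ?_⟩
  · intro e' r
    by_cases hee : e' = e
    · subst hee; simp [hCe]
    · simpa [hee] using hd.eq_st e' r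
  · intro e' r k
    by_cases hee : e' = e
    · subst hee; simp
    · have h := hd.mem_sm e' r k
      simpa [hee] using h

/-- The coherent set stored in a location. -/
def LocS.summaries : LocS Q → Set (Summary Q)
  | .s0 => ∅
  | .co SS => SS
  | .coS SS => SS

theorem Describes.vassStep (hWO : P.WaitOnly) {tf : Q × Act M × Q}
    {c c' : LocS Q × (Ctr P → ℕ)} (h : (VPS P tf).Step c c') (h0 : c.1 ≠ .s0)
    {f : Fin n → Ctr P} {C : Fin n → Q} (hd : Describes c.1.summaries c.2 f C) :
    c'.1 ≠ .s0 ∧ ∃ f' C', Describes c'.1.summaries c'.2 f' C' ∧ (C = C' ∨ P.StepAny C C') ∧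
      ((∃ SS, c'.1 = .coS SS) → ∃ e, P.Step e tf C C') := by
  obtain ⟨l, v⟩ := c
  obtain ⟨l', v'⟩ := c'
  obtain ⟨δ, hδ, hv⟩ := h
  rcases hδ with h | h | ⟨t, SS, δ, SS', -, h, hT⟩ | ⟨SS, δ, SS', h, hT⟩ | ⟨SS, h⟩ |
    ⟨SS, δ, h, hE⟩
  · cases h; exact (h0 rfl).elim
  · cases h; exact (h0 rfl).elim
  · cases h
    obtain ⟨f', C', h1, e, h2⟩ := hd.deltaT hWO hT hv
    exact ⟨by simp, f', C', h1, Or.inr ⟨e, t, h2⟩, by simp⟩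
  · cases h
    obtain ⟨f', C', h1, e, h2⟩ := hd.deltaT hWO hT hv
    exact ⟨by simp, f', C', h1, Or.inr ⟨e, tf, h2⟩, fun _ => ⟨e, h2⟩⟩
  · cases h
    have : v' = v := by
      funext x
      simpa using hv x
    subst this
    exact ⟨by simp, f, C, hd, Or.inl rfl, by simp⟩
  · cases h
    obtain ⟨f', h1⟩ := hd.deltaE hE hv
    exact ⟨by simp, f', C, h1, Or.inl rfl, by simp⟩

theorem exists_exec_of_vass (hWO : P.WaitOnly) {tf : Q × Act M × Q}
    {c : ℕ → LocS Q × (Ctr P → ℕ)} (h0 : c 0 = (LocS.s0, 0))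
    (hstep : ∀ i, (VPS P tf).Step (c i) (c (i + 1)))
    (hinf : ∀ i, ∃ j, i < j ∧ ∃ SS, (c j).1 = LocS.coS SS) :
    ∃ (n : ℕ) (ρ : Exec P n), ρ.len = ⊤ ∧ ∃ e : Fin n,
      ∀ i : ℕ, ∃ j : ℕ, i < j ∧ P.Step e tf (ρ.conf j) (ρ.conf (j + 1)) := by
  classical
  let xin : Ctr P := ⟨.st P.qin, hWO.2.1⟩
  have hinit : ∀ i, (c i).1 = .s0 → ∀ x, x ≠ xin → (c i).2 x = 0 := by
    intro i
    induction i with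
    | zero => simp [h0]
    | succ i ih =>
      intro hi x hx
      obtain ⟨δ, hδ, hv⟩ := hstep i
      rcases hδ with h | h | ⟨t, SS, δ, SS', -, h, hT⟩ | ⟨SS, δ, SS', h, hT⟩ | ⟨SS, h⟩ |
        ⟨SS, δ, h, hE⟩
      · simp only [Prod.mk.injEq] at h
        have h1 := ih h.1 x hx
        have h2 := hv x
        rw [h.2.1, h1, chi_apply xin x, if_neg hx] at h2
        simpa using h2
      all_goals simp [hi] at h
  have hex : ∃ i, (c i).1 ≠ .s0 := by
    obtain ⟨j, -, SS, hSS⟩ := hinf 0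
    exact ⟨j, by simp [hSS]⟩
  obtain ⟨m, hm, hmin⟩ : ∃ m, (c m).1 = .s0 ∧ (c (m + 1)).1 ≠ .s0 := by
    by_contra! hc
    obtain ⟨i, hi⟩ := hex
    exact hi (Nat.rec (by simp [h0]) hc i)
  obtain ⟨hloc, hval⟩ : (c (m + 1)).1 = .co ∅ ∧ (c (m + 1)).2 = (c m).2 := by
    obtain ⟨δ, hδ, hv⟩ := hstep m
    rcases hδ with h | h | ⟨t, SS, δ, SS', -, h, hT⟩ | ⟨SS, δ, SS', h, hT⟩ | ⟨SS, h⟩ |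
      ⟨SS, δ, h, hE⟩
    · simp only [Prod.mk.injEq] at h
      exact (hmin h.2.2).elim
    · simp only [Prod.mk.injEq] at h
      refine ⟨h.2.2, funext fun x => ?_⟩
      simpa [h.2.1] using hv x
    all_goals simp [hm] at h
  let n := (c m).2 xin
  have hbase : (c (m + 1)).1 ≠ .s0 ∧ Describes (n := n) (c (m + 1)).1.summaries (c (m + 1)).2
      (fun _ => xin) (fun _ => P.qin) := by
    refine ⟨hmin, ?_, ?_, ?_⟩
    · intro x
      rw [hval]
      by_cases hx : xin = x
      · subst hx; simp [countFiber, n]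
      · simp [countFiber, hx, hinit m hm x (Ne.symm hx)]
    · simp [xin]
    · simp [xin]
  obtain ⟨F, hF0, hF⟩ := exists_seq_of_invariant
    (x₀ := ((fun _ => xin, fun _ => P.qin) : (Fin n → Ctr P) × (Fin n → Q)))
    (fun i x => (c (m + 1 + i)).1 ≠ .s0 ∧
      Describes (c (m + 1 + i)).1.summaries (c (m + 1 + i)).2 x.1 x.2)
    (R := fun i x y => (x.2 = y.2 ∨ P.StepAny x.2 y.2) ∧
      ((∃ SS, (c (m + 1 + i + 1)).1 = .coS SS) → ∃ e, P.Step e tf x.2 y.2)) hbase (by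
    rintro i x ⟨h1, h2⟩
    obtain ⟨h3, f', C', h4⟩ := h2.vassStep hWO (hstep (m + 1 + i)) h1
    exact ⟨(f', C'), ⟨h3, h4.1⟩, h4.2⟩)
  obtain ⟨C, hC0, hC1, hC2⟩ := exists_run_of_reflTransGen
    (r := P.StepAny) (s := fun x y : Fin n → Q => ∃ e, P.Step e tf x y)
    (fun x y ⟨e, h⟩ => ⟨e, tf, h⟩) (fun i => (F i).2)
    (fun i => (hF i).2.1.elim (fun h => by rw [h]) .single)
    (by
      intro i
      obtain ⟨j, hj, hSS⟩ := hinf (m + 1 + i + 1)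
      obtain ⟨k, rfl⟩ := Nat.exists_eq_add_of_lt hj
      exact ⟨i + 1 + k, by omega, _, _, .refl, (hF (i + 1 + k)).2.2
        (by
          rwa [show m + 1 + (i + 1 + k) + 1 = m + 1 + i + 1 + k + 1 by omega]), .refl⟩)
  obtain ⟨e, he⟩ : ∃ e : Fin n, ∀ i, ∃ j, i < j ∧ P.Step e tf (C j) (C (j + 1)) := by
    by_contra! hc
    choose B hB using hc
    obtain ⟨j, hj, e, he⟩ := hC2 (Finset.univ.sup B)
    exact hB e j ((Finset.le_sup (Finset.mem_univ e)).trans_lt hj) he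
  exact ⟨n, ⟨Nat.pos_of_ne_zero fun h => (h ▸ e).elim0, ⊤, le_top, C,
    fun e => by simp [hC0, hF0], fun i _ => hC1 i⟩, rfl, e, he⟩

/-! ### Exit times -/

/-- From state `s` at time `i`, legal receptions of the broadcasts `b i, b (i+1), …` can keep a
process waiting until time `τ`, when it is in state `a` (if `τ` is finite). -/
def WaitPath (P : Protocol Q M) (b : ℕ → M) (i : ℕ) (a s : Q) (τ : ℕ∞) : Prop :=
  ∃ f : ℕ → Q, f i = s ∧ (i : ℕ∞) ≤ τ ∧
    (∀ j, i ≤ j → (j : ℕ∞) < τ → P.isWaiting (f j) ∧ Legal P (b j) (f j) (f (j + 1))) ∧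
    ∀ m : ℕ, τ = m → f m = a

noncomputable def exitTime (P : Protocol Q M) (b : ℕ → M) (i : ℕ) (a s : Q) : ℕ∞ :=
  sInf {τ | WaitPath P b i a s τ}

theorem waitPath_exitTime {b : ℕ → M} {i : ℕ} {a s : Q} (h : ∃ τ, WaitPath P b i a s τ) :
    WaitPath P b i a s (exitTime P b i a s) :=
  csInf_mem (s := {τ | WaitPath P b i a s τ}) h

theorem exitTime_le {b : ℕ → M} {i : ℕ} {a s : Q} {τ : ℕ∞} (h : WaitPath P b i a s τ) :
    exitTime P b i a s ≤ τ :=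
  sInf_le h

theorem WaitPath.lt {b : ℕ → M} {i : ℕ} {a s : Q} {τ : ℕ∞} (h : WaitPath P b i a s τ)
    (ha : ¬ P.isWaiting a) (hs : P.isWaiting s) : (i : ℕ∞) < τ := by
  obtain ⟨f, rfl, hi, -, hf⟩ := h
  refine lt_of_le_of_ne hi fun he => ha ?_
  rwa [← hf i he.symm]

/-- Following a shortest waiting path preserves the exit time. -/
theorem exists_shortest_move {b : ℕ → M} {i : ℕ} {a s : Q} (ha : ¬ P.isWaiting a)
    (hs : P.isWaiting s) (h : ∃ τ, WaitPath P b i a s τ) :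
    ∃ s', Legal P (b i) s s' ∧ (∃ τ, WaitPath P b (i + 1) a s' τ) ∧
      exitTime P b (i + 1) a s' = exitTime P b i a s ∧
      (exitTime P b i a s = (i + 1 : ℕ) → s' = a) ∧
      (exitTime P b i a s ≠ (i + 1 : ℕ) → P.isWaiting s') := by
  have hE := waitPath_exitTime h
  set E := exitTime P b i a s with hEdef
  have hlt := hE.lt ha hs
  obtain ⟨f, hfi, -, hf, hfa⟩ := hE
  have hle : ((i + 1 : ℕ) : ℕ∞) ≤ E := by
    push_cast
    exact Order.add_one_le_of_lt hlt
  have hP : WaitPath P b (i + 1) a (f (i + 1)) E :=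
    ⟨f, rfl, hle, fun j hj => hf j (by omega), hfa⟩
  refine ⟨f (i + 1), hfi ▸ (hf i le_rfl hlt).2, ⟨E, hP⟩, ?_, fun he => hfa _ he, fun hne =>
    (hf (i + 1) (by omega) (lt_of_le_of_ne hle hne.symm)).1⟩
  refine le_antisymm (exitTime_le hP) ?_
  obtain ⟨g, hgi, hg0, hg, hga⟩ := waitPath_exitTime ⟨E, hP⟩
  refine exitTime_le ⟨fun j => if j = i then s else g j, by simp, le_trans (by simp) hg0, ?_, ?_⟩
  · intro j hj hjτ
    by_cases hji : j = i
    · subst hji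
      simpa [hs, hgi, hfi] using (hf j le_rfl hlt).2
    · have : j + 1 ≠ i := by omega
      simpa [hji, this] using hg j (by omega) hjτ
  · intro m hm
    have : m ≠ i := by
      rintro rfl
      rw [hm] at hg0
      have := Nat.cast_le.mp hg0
      omega
    simpa [this] using hga m hm

open Classical in
/-- The first action state of the sequence `f` from index `i` on (`P.qin` if there is none). -/
noncomputable def nextAction (P : Protocol Q M) (f : ℕ → Q) (i : ℕ) : Q :=
  if h : ∃ m, i ≤ m ∧ ¬ P.isWaiting (f m) then f (Nat.find h) else P.qin

theorem nextAction_mem (h0 : ¬ P.isWaiting P.qin) (f : ℕ → Q) (i : ℕ) :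
    ¬ P.isWaiting (nextAction P f i) := by
  classical
  unfold nextAction
  split_ifs with h
  · exact (Nat.find_spec h).2
  · exact h0

theorem nextAction_of_action {f : ℕ → Q} {i : ℕ} (h : ¬ P.isWaiting (f i)) :
    nextAction P f i = f i := by
  classical
  have hex : ∃ m, i ≤ m ∧ ¬ P.isWaiting (f m) := ⟨i, le_rfl, h⟩
  rw [nextAction, dif_pos hex]
  congr 1
  exact le_antisymm (Nat.find_min' hex ⟨le_rfl, h⟩) (Nat.find_spec hex).1

theorem nextAction_succ {f : ℕ → Q} {i : ℕ} (h : P.isWaiting (f i)) :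
    nextAction P f (i + 1) = nextAction P f i := by
  classical
  have hiff : ∀ m, (i + 1 ≤ m ∧ ¬ P.isWaiting (f m)) ↔ (i ≤ m ∧ ¬ P.isWaiting (f m)) := by
    intro m
    refine ⟨fun hm => ⟨by omega, hm.2⟩, fun hm => ⟨?_, hm.2⟩⟩
    exact Nat.lt_of_le_of_ne hm.1 (by rintro rfl; exact hm.2 h)
  simp only [nextAction, hiff]

/-- A sequence making legal moves while waiting is itself a waiting path to its next action
state. -/
theorem exists_waitPath_nextAction {b : ℕ → M} {f : ℕ → Q} {i : ℕ}
    (h : ∀ j, i ≤ j → P.isWaiting (f j) → Legal P (b j) (f j) (f (j + 1))) :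
    ∃ τ, WaitPath P b i (nextAction P f i) (f i) τ ∧
      ∀ m : ℕ, i ≤ m → ¬ P.isWaiting (f m) → τ ≤ m := by
  classical
  by_cases hex : ∃ m, i ≤ m ∧ ¬ P.isWaiting (f m)
  · refine ⟨Nat.find hex, ⟨f, rfl, by exact_mod_cast (Nat.find_spec hex).1, ?_, ?_⟩, ?_⟩
    · intro j hj hjt
      have hw : P.isWaiting (f j) := by
        by_contra hc
        exact Nat.find_min hex (Nat.cast_lt.mp hjt) ⟨hj, hc⟩
      exact ⟨hw, h j hj hw⟩
    · intro m hm
      rw [nextAction, dif_pos hex, Nat.cast_injective hm]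
    · intro m hm hw
      exact_mod_cast Nat.find_min' hex ⟨hm, hw⟩
  · have hw : ∀ j, i ≤ j → P.isWaiting (f j) := by
      intro j hj
      by_contra hc
      exact hex ⟨j, hj, hc⟩
    refine ⟨⊤, ⟨f, rfl, le_top, fun j hj _ => ⟨hw j hj, h j hj (hw j hj)⟩, ?_⟩, ?_⟩
    · intro m hm
      exact (ENat.natCast_ne_top m hm.symm).elim
    · intro m hm hc
      exact (hc (hw m hm)).elim

/-! ### Labelled configurations -/

/-- A configuration in which every process carries an exit state and an identifier, which are
meaningful while it is waiting. -/
structure Labelled (P : Protocol Q M) (n : ℕ) where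
  st : Fin n → Q
  tgt : Fin n → Q
  id : Fin n → ℕ
  tgt_mem : ∀ p, ¬ P.isWaiting (tgt p)
  id_pos : ∀ p, 1 ≤ id p
  id_le : ∀ p, id p ≤ nW P + 1
  id_eq : ∀ p p', P.isWaiting (st p) → st p = st p' → tgt p = tgt p' → id p = id p'

namespace Labelled

open Classical in
/-- The counter of a process. -/
noncomputable def ctr (l : Labelled P n) (p : Fin n) : Ctr P :=
  if h : P.isWaiting (l.st p) then ⟨.sm (l.tgt p) (l.id p), l.tgt_mem p, l.id_pos p, l.id_le p⟩
  else ⟨.st (l.st p), h⟩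

theorem ctr_of_waiting (l : Labelled P n) {p : Fin n} (h : P.isWaiting (l.st p)) :
    (l.ctr p).val = .sm (l.tgt p) (l.id p) := by simp [ctr, h]

theorem ctr_of_action (l : Labelled P n) {p : Fin n} (h : ¬ P.isWaiting (l.st p)) :
    (l.ctr p).val = .st (l.st p) := by simp [ctr, h]

/-- States of the waiting processes with label `(a, k)`. -/
def print (l : Labelled P n) (a : Q) (k : ℕ) : Set Q :=
  {s | ∃ p, P.isWaiting (l.st p) ∧ l.tgt p = a ∧ l.id p = k ∧ l.st p = s}

def summ (l : Labelled P n) (p : Fin n) : Summary Q :=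
  ⟨l.print (l.tgt p) (l.id p), l.tgt p, l.id p⟩

def summaries (l : Labelled P n) : Set (Summary Q) :=
  {S | ∃ p, P.isWaiting (l.st p) ∧ l.summ p = S}

theorem print_subset (l : Labelled P n) (a : Q) (k : ℕ) : l.print a k ⊆ P.QW := by
  rintro s ⟨p, hp, -, -, rfl⟩
  exact hp

theorem coherent (l : Labelled P n) : Coherent P l.summaries := by
  refine ⟨?_, ?_⟩
  · rintro S ⟨p, hp, rfl⟩
    exact ⟨l.print_subset _ _, l.tgt_mem p, l.id_pos p, l.id_le p⟩
  · rintro S1 ⟨p, hp, rfl⟩ S2 ⟨p', hp', rfl⟩ hne (htgt : l.tgt p = l.tgt p')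
    have hid : l.id p ≠ l.id p' := fun hid => hne (by simp [summ, htgt, hid])
    refine ⟨hid, Set.eq_empty_of_forall_notMem ?_⟩
    rintro s ⟨⟨r, hr, h1, h2, h3⟩, r', hr', h1', h2', h3'⟩
    refine hid ?_
    rw [← h2, ← h2']
    exact l.id_eq r r' hr (h3.trans h3'.symm) (by rw [h1, h1', htgt])

theorem mem_labs (l : Labelled P n) {a : Q} {k : ℕ} :
    (a, k) ∈ labs l.summaries ↔ ∃ p, P.isWaiting (l.st p) ∧ l.tgt p = a ∧ l.id p = k := by
  constructor
  · rintro ⟨S, ⟨p, hp, rfl⟩, h⟩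
    cases h
    exact ⟨p, hp, rfl, rfl⟩
  · rintro ⟨p, hp, rfl, rfl⟩
    exact ⟨_, ⟨p, hp, rfl⟩, rfl⟩

/-- A broadcast of `b` by `p₀` from `l` to `l'`, in which waiting processes move according to
`σ` and processes with the same label finish waiting simultaneously. -/
structure Broadcast (l l' : Labelled P n) (p₀ : Fin n) (b : M) (σ : Q → Q → Q) : Prop where
  mem : (l.st p₀, Act.send b, l'.st p₀) ∈ P.T
  action : ¬ P.isWaiting (l.st p₀)
  st_action : ∀ p, p ≠ p₀ → ¬ P.isWaiting (l.st p) → l'.st p = l.st p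
  st_waiting : ∀ p, P.isWaiting (l.st p) → l'.st p = σ (l.tgt p) (l.st p)
  legal : ∀ p, P.isWaiting (l.st p) → Legal P b (l.st p) (l'.st p)
  tgt_eq : ∀ p, P.isWaiting (l.st p) → l'.tgt p = l.tgt p
  id_eq : ∀ p, P.isWaiting (l.st p) → l'.id p = l.id p
  exit : ∀ p, P.isWaiting (l.st p) → ¬ P.isWaiting (l'.st p) → l'.st p = l.tgt p
  sync : ∀ p p', P.isWaiting (l.st p) → P.isWaiting (l.st p') → l.tgt p = l.tgt p' →
    l.id p = l.id p' → P.isWaiting (l'.st p) → P.isWaiting (l'.st p')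
  join : ∀ p, P.isWaiting (l.st p) → l.tgt p = l'.tgt p₀ → l.id p = l'.id p₀ →
    P.isWaiting (l'.st p₀) → P.isWaiting (l'.st p)

namespace Broadcast

variable {l l' : Labelled P n} {p₀ : Fin n} {b : M} {σ : Q → Q → Q}

theorem waiting_of_waiting (h : Broadcast l l' p₀ b σ) {p : Fin n} (hp : p ≠ p₀)
    (hw : P.isWaiting (l'.st p)) : P.isWaiting (l.st p) := by
  by_contra hc
  exact hc (h.st_action p hp hc ▸ hw)

theorem image_print (h : Broadcast l l' p₀ b σ) (a : Q) (k : ℕ) :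
    σ a '' l.print a k =
      {s | ∃ p, P.isWaiting (l.st p) ∧ l.tgt p = a ∧ l.id p = k ∧ l'.st p = s} := by
  ext s
  constructor
  · rintro ⟨_, ⟨p, hp, rfl, rfl, rfl⟩, rfl⟩
    exact ⟨p, hp, rfl, rfl, h.st_waiting p hp⟩
  · rintro ⟨p, hp, rfl, rfl, rfl⟩
    exact ⟨_, ⟨p, hp, rfl, rfl, rfl⟩, (h.st_waiting p hp).symm⟩

theorem recvFun (h : Broadcast l l' p₀ b σ) (a : Q) (k : ℕ) :
    RecvFun P b (l.print a k) (σ a) := by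
  rintro s ⟨p, hp, rfl, rfl, rfl⟩
  rw [← h.st_waiting p hp]
  exact h.legal p hp

theorem image_print_of_waiting (h : Broadcast l l' p₀ b σ) {p : Fin n}
    (hp : P.isWaiting (l.st p)) (hp' : P.isWaiting (l'.st p)) :
    σ (l.tgt p) '' l.print (l.tgt p) (l.id p) ⊆ P.QW := by
  rw [h.image_print]
  rintro s ⟨r, hr, h1, h2, rfl⟩
  exact h.sync p r hp hr h1.symm h2.symm hp'

theorem image_print_of_action (h : Broadcast l l' p₀ b σ) {p : Fin n}
    (hp : P.isWaiting (l.st p)) (hp' : ¬ P.isWaiting (l'.st p)) :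
    σ (l.tgt p) '' l.print (l.tgt p) (l.id p) = {l.tgt p} := by
  rw [h.image_print]
  refine Set.eq_singleton_iff_unique_mem.mpr ⟨⟨p, hp, rfl, rfl, h.exit p hp hp'⟩, ?_⟩
  rintro s ⟨r, hr, h1, h2, rfl⟩
  rw [h.exit r hr fun hc => hp' (h.sync r p hr hp h1 h2 hc), h1]

theorem print_of_waiting (h : Broadcast l l' p₀ b σ) {p : Fin n}
    (hp : P.isWaiting (l.st p)) (hp' : P.isWaiting (l'.st p)) :
    l'.print (l.tgt p) (l.id p) = σ (l.tgt p) '' l.print (l.tgt p) (l.id p) ∪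
      {s | P.isWaiting (l'.st p₀) ∧ l'.tgt p₀ = l.tgt p ∧ l'.id p₀ = l.id p ∧ l'.st p₀ = s} := by
  rw [h.image_print]
  ext s
  constructor
  · rintro ⟨r, hr, h1, h2, h3⟩
    by_cases hr0 : r = p₀
    · subst hr0
      exact Or.inr ⟨hr, h1, h2, h3⟩
    · have hw := h.waiting_of_waiting hr0 hr
      exact Or.inl ⟨r, hw, h.tgt_eq r hw ▸ h1, h.id_eq r hw ▸ h2, h3⟩
  · rintro (⟨r, hr, h1, h2, rfl⟩ | hs)
    · exact ⟨r, h.sync p r hp hr h1.symm h2.symm hp', (h.tgt_eq r hr).trans h1,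
        (h.id_eq r hr).trans h2, rfl⟩
    · exact ⟨p₀, hs⟩

open Classical in
/-- The evolution of the summaries of `l` which the sender does not join. -/
noncomputable def next (P : Protocol Q M) (σ : Q → Q → Q) (S : Summary Q) : Option (Summary Q) :=
  if σ S.exit '' S.pr ⊆ P.QW then some ⟨σ S.exit '' S.pr, S.exit, S.id⟩ else none

theorem next_of_waiting (h : Broadcast l l' p₀ b σ) {p : Fin n}
    (hp : P.isWaiting (l.st p)) (hp' : P.isWaiting (l'.st p)) :
    next P σ (l.summ p) =
      some ⟨σ (l.tgt p) '' l.print (l.tgt p) (l.id p), l.tgt p, l.id p⟩ :=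
  if_pos (h.image_print_of_waiting hp hp')

theorem next_of_action (h : Broadcast l l' p₀ b σ) {p : Fin n}
    (hp : P.isWaiting (l.st p)) (hp' : ¬ P.isWaiting (l'.st p)) :
    next P σ (l.summ p) = none := by
  refine if_neg ?_
  simp only [summ]
  rw [h.image_print_of_action hp hp', Set.singleton_subset_iff]
  exact l.tgt_mem p

theorem stepsTo_next (h : Broadcast l l' p₀ b σ) {S : Summary Q} (hS : S ∈ l.summaries) :
    stepsTo P (l.st p₀, Act.send b, l'.st p₀) S (next P σ S) := by
  obtain ⟨p, hp, rfl⟩ := hS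
  by_cases hp' : P.isWaiting (l'.st p)
  · rw [h.next_of_waiting hp hp']
    exact ⟨_, _, _, rfl, h.mem, _, h.recvFun _ _, rfl, rfl, rfl,
      h.image_print_of_waiting hp hp'⟩
  · rw [h.next_of_action hp hp']
    exact ⟨_, _, _, rfl, h.mem, _, h.recvFun _ _, h.image_print_of_action hp hp'⟩

/-- A label not shared by the sender evolves as prescribed by `next`. -/
theorem next_eq_some_iff (h : Broadcast l l' p₀ b σ) {p : Fin n} (hp : P.isWaiting (l.st p))
    (hne : ¬ (P.isWaiting (l'.st p₀) ∧ l'.tgt p₀ = l.tgt p ∧ l'.id p₀ = l.id p))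
    (S' : Summary Q) :
    next P σ (l.summ p) = some S' ↔ P.isWaiting (l'.st p) ∧ l'.summ p = S' := by
  by_cases hp' : P.isWaiting (l'.st p)
  · have hpr := h.print_of_waiting hp hp'
    have : {s | P.isWaiting (l'.st p₀) ∧ l'.tgt p₀ = l.tgt p ∧ l'.id p₀ = l.id p ∧
        l'.st p₀ = s} = ∅ := by
      ext s
      simp only [Set.mem_ofPred_eq, Set.mem_empty_iff_false, iff_false]
      rintro ⟨h1, h2, h3, -⟩
      exact hne ⟨h1, h2, h3⟩
    rw [this, Set.union_empty] at hpr
    rw [h.next_of_waiting hp hp']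
    simp [hp', summ, h.tgt_eq p hp, h.id_eq p hp, hpr]
  · simp [h.next_of_action hp hp', hp']

theorem deltaT (h : Broadcast l l' p₀ b σ) :
    DeltaT P (l.st p₀, Act.send b, l'.st p₀) l.summaries
      (fun y => chi P (l'.ctr p₀).val y - chi P (l.ctr p₀).val y) l'.summaries := by
  refine ⟨l.coherent, l'.coherent, _, _, _, rfl, h.mem, ?_⟩
  rw [l.ctr_of_action h.action]
  by_cases hw : P.isWaiting (l'.st p₀)
  · rw [l'.ctr_of_waiting hw]
    by_cases hj : ∃ p, P.isWaiting (l.st p) ∧ l.tgt p = l'.tgt p₀ ∧ l.id p = l'.id p₀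
    · obtain ⟨p, hp, hpt, hpi⟩ := hj
      have hp' := h.join p hp hpt hpi hw
      have hpr : (l'.summ p₀).pr =
          σ (l.tgt p) '' l.print (l.tgt p) (l.id p) ∪ {l'.st p₀} := by
        have := h.print_of_waiting hp hp'
        rw [summ, ← hpt, ← hpi, this]
        simp [hw, hpt, hpi]
      refine Or.inr (Or.inl ⟨hw, l.summ p, ⟨p, hp, rfl⟩, l'.summ p₀,
        ⟨_, _, _, rfl, h.mem, hw, σ (l.tgt p), h.recvFun _ _, hpt.symm, hpi.symm, hpr, ?_⟩,
        ⟨next P σ, fun S hS _ => h.stepsTo_next hS, ?_⟩, by simp [summ, hpt, hpi]⟩)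
      · refine hpr.symm.subset.trans ?_
        exact l'.print_subset _ _
      · have hnj : ∀ r, l.summ r ≠ l.summ p →
            ¬ (P.isWaiting (l'.st p₀) ∧ l'.tgt p₀ = l.tgt r ∧ l'.id p₀ = l.id r) := by
          rintro r hr ⟨-, h1, h2⟩
          exact hr (by simp [summ, hpt, hpi, h1, h2])
        ext S'
        constructor
        · rintro ⟨r, hr, rfl⟩
          by_cases hr0 : r = p₀
          · exact Or.inl (by rw [hr0])
          · have hwr := h.waiting_of_waiting hr0 hr
            by_cases hrp : l.summ r = l.summ p
            · have h1 : l.tgt r = l.tgt p := congrArg Summary.exit hrp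
              have h2 : l.id r = l.id p := congrArg Summary.id hrp
              refine Or.inl ?_
              simp [summ, h.tgt_eq r hwr, h.id_eq r hwr, h1, h2, hpt, hpi]
            · exact Or.inr ⟨l.summ r, ⟨r, hwr, rfl⟩, hrp,
                (h.next_eq_some_iff hwr (hnj r hrp) _).mpr ⟨hr, rfl⟩⟩
        · rintro (rfl | ⟨_, ⟨r, hr, rfl⟩, hrp, hn⟩)
          · exact ⟨p₀, hw, rfl⟩
          · exact ⟨r, (h.next_eq_some_iff hr (hnj r hrp) _).mp hn⟩
    · have hnj : ∀ r, P.isWaiting (l.st r) →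
          ¬ (P.isWaiting (l'.st p₀) ∧ l'.tgt p₀ = l.tgt r ∧ l'.id p₀ = l.id r) :=
        fun r hr hc => hj ⟨r, hr, hc.2.1.symm, hc.2.2.symm⟩
      have hsum : l'.summ p₀ = ⟨{l'.st p₀}, l'.tgt p₀, l'.id p₀⟩ := by
        simp only [summ, Summary.mk.injEq, and_true]
        refine Set.eq_singleton_iff_unique_mem.mpr ⟨⟨p₀, hw, rfl, rfl, rfl⟩, ?_⟩
        rintro s ⟨r, hr, h1, h2, rfl⟩
        by_cases hr0 : r = p₀
        · rw [hr0]
        · have hwr := h.waiting_of_waiting hr0 hr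
          exact (hj ⟨r, hwr, h.tgt_eq r hwr ▸ h1, h.id_eq r hwr ▸ h2⟩).elim
      refine Or.inr (Or.inr ⟨hw, l'.tgt p₀, l'.tgt_mem p₀, l'.id p₀, l'.id_pos p₀, l'.id_le p₀,
        fun hc => hj (l.mem_labs.mp hc), ⟨next P σ, fun S hS => h.stepsTo_next hS, ?_⟩, rfl⟩)
      rw [← hsum]
      ext S'
      constructor
      · rintro ⟨r, hr, rfl⟩
        by_cases hr0 : r = p₀
        · exact Or.inl (by rw [hr0])
        · have hwr := h.waiting_of_waiting hr0 hr
          exact Or.inr ⟨l.summ r, ⟨r, hwr, rfl⟩,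
            (h.next_eq_some_iff hwr (hnj r hwr) _).mpr ⟨hr, rfl⟩⟩
      · rintro (rfl | ⟨_, ⟨r, hr, rfl⟩, hn⟩)
        · exact ⟨p₀, hw, rfl⟩
        · exact ⟨r, (h.next_eq_some_iff hr (hnj r hr) _).mp hn⟩
  · rw [l'.ctr_of_action hw]
    refine Or.inl ⟨hw, ⟨next P σ, fun S hS => h.stepsTo_next hS, ?_⟩, rfl⟩
    ext S'
    constructor
    · rintro ⟨r, hr, rfl⟩
      have hwr := h.waiting_of_waiting (by rintro rfl; exact hw hr) hr
      exact ⟨l.summ r, ⟨r, hwr, rfl⟩,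
        (h.next_eq_some_iff hwr (fun hc => hw hc.1) _).mpr ⟨hr, rfl⟩⟩
    · rintro ⟨_, ⟨r, hr, rfl⟩, hn⟩
      exact ⟨r, (h.next_eq_some_iff hr (fun hc => hw hc.1) _).mp hn⟩

end Broadcast

end Labelled

/-! ### Runs of the tagged VASS -/

open Relation

theorem reach_of_exit {tf : Q × Act M × Q} {SS : Set (Summary Q)} (hco : Coherent P SS)
    {f g : Fin n → Ctr P}
    (h : ∀ p, f p = g p ∨ ∃ a k, (f p).val = .sm a k ∧ (g p).val = .st a ∧ (a, k) ∉ labs SS) :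
    (VPS P tf).Reach (.co SS, countFiber f) (.co SS, countFiber g) := by
  classical
  have key : ∀ s : Finset (Fin n), (VPS P tf).Reach (.co SS, countFiber f)
      (.co SS, countFiber (s.piecewise g f)) := by
    intro s
    induction s using Finset.induction_on with
    | empty => rw [Finset.piecewise_empty]; exact .refl
    | insert p s hp ih =>
      rw [Finset.piecewise_insert]
      have hfp : s.piecewise g f p = f p := Finset.piecewise_eq_of_notMem _ _ _ hp
      rcases h p with hp | ⟨a, k, hf, hg, hlab⟩
      · rw [Function.update_eq_self_iff.mpr (by rw [hfp, hp])]
        exact ih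
      · refine ih.tail ⟨_, Or.inr <| Or.inr <| Or.inr <| Or.inr <| Or.inr ⟨SS, _, rfl, hco, a,
          ?_, k, ?_, ?_, hlab, rfl⟩, fun x => ?_⟩
        · have := (f p).2
          rw [hf] at this
          exact this.1
        · have := (f p).2
          rw [hf] at this
          exact this.2.1
        · have := (f p).2
          rw [hf] at this
          exact this.2.2
        · rw [countFiber_update_ctr, hfp, ← hf, ← hg]
  have := key Finset.univ
  rwa [Finset.piecewise_univ] at this

theorem reach_initial (tf : Q × Act M × Q) (xin : Ctr P) (hxin : xin.val = .st P.qin) (n : ℕ) :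
    (VPS P tf).Reach (.s0, 0) (.co ∅, countFiber fun _ : Fin n => xin) := by
  classical
  have key : ∀ m : ℕ, (VPS P tf).Reach (.s0, 0) (.s0, fun x => if x = xin then m else 0) := by
    intro m
    induction m with
    | zero =>
      have : (fun x : Ctr P => if x = xin then 0 else 0) = 0 := by funext x; simp
      rw [this]
      exact .refl
    | succ m ih =>
      refine ih.tail ⟨_, Or.inl rfl, fun x => ?_⟩
      rw [← hxin, chi_apply]
      dsimp only
      split_ifs <;> simp
  refine (key n).tail ⟨0, Or.inr (Or.inl rfl), fun x => ?_⟩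
  by_cases hx : x = xin
  · simp [countFiber, hx]
  · simp [countFiber, hx, Ne.symm hx]

/-- The VASS configuration of a labelled configuration. -/
noncomputable def Labelled.conf (l : Labelled P n) : LocS Q × (Ctr P → ℕ) :=
  (.co l.summaries, countFiber l.ctr)

/-- A step of the tagged VASS which enters a tagged location. -/
def TaggedStep (P : Protocol Q M) (tf : Q × Act M × Q) (x y : LocS Q × (Ctr P → ℕ)) : Prop :=
  (VPS P tf).Step x y ∧ ∃ SS, y.1 = .coS SS

theorem Labelled.Broadcast.reach {l l' : Labelled P n} {p₀ : Fin n} {b : M} {σ : Q → Q → Q}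
    (h : Broadcast l l' p₀ b σ) (tf : Q × Act M × Q) :
    (VPS P tf).Reach l.conf l'.conf ∧ ((l.st p₀, Act.send b, l'.st p₀) = tf →
      ∃ y, TaggedStep P tf l.conf y ∧ (VPS P tf).Reach y l'.conf) := by
  classical
  let f := Function.update l.ctr p₀ (l'.ctr p₀)
  have hf : ∀ x, (countFiber f x : ℤ) =
      countFiber l.ctr x + (chi P (l'.ctr p₀).val x - chi P (l.ctr p₀).val x) := by
    intro x
    exact countFiber_update_ctr ..
  have hflush : (VPS P tf).Reach (.co l'.summaries, countFiber f) l'.conf := by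
    refine reach_of_exit l'.coherent fun p => ?_
    by_cases hp0 : p = p₀
    · subst hp0
      exact Or.inl (Function.update_self ..)
    · simp only [f, Function.update_of_ne hp0]
      by_cases hp : P.isWaiting (l.st p)
      · by_cases hp' : P.isWaiting (l'.st p)
        · refine Or.inl (Subtype.ext ?_)
          rw [l.ctr_of_waiting hp, l'.ctr_of_waiting hp', h.tgt_eq p hp, h.id_eq p hp]
        · refine Or.inr ⟨_, _, l.ctr_of_waiting hp, ?_, ?_⟩
          · rw [l'.ctr_of_action hp', h.exit p hp hp']
          · intro hc
            obtain ⟨r, hr, h1, h2⟩ := l'.mem_labs.mp hc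
            by_cases hr0 : r = p₀
            · subst hr0
              exact hp' (h.join p hp h1.symm h2.symm hr)
            · have hwr := h.waiting_of_waiting hr0 hr
              exact hp' (h.sync r p hwr hp (h.tgt_eq r hwr ▸ h1) (h.id_eq r hwr ▸ h2) hr)
      · have hst := h.st_action p hp0 hp
        refine Or.inl (Subtype.ext ?_)
        rw [l.ctr_of_action hp, l'.ctr_of_action (hst ▸ hp), hst]
  have htag : (l.st p₀, Act.send b, l'.st p₀) = tf →
      ∃ y, TaggedStep P tf l.conf y ∧ (VPS P tf).Reach y l'.conf := by
    rintro rfl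
    refine ⟨(.coS l'.summaries, countFiber f), ⟨⟨_, Or.inr <| Or.inr <| Or.inr <| Or.inl
      ⟨_, _, _, rfl, h.deltaT⟩, hf⟩, _, rfl⟩, hflush.head ⟨0, Or.inr <| Or.inr <| Or.inr <|
      Or.inr <| Or.inl ⟨_, rfl⟩, by simp⟩⟩
  refine ⟨?_, htag⟩
  by_cases htf : (l.st p₀, Act.send b, l'.st p₀) = tf
  · obtain ⟨y, h1, h2⟩ := htag htf
    exact h2.head h1.1
  · exact hflush.head ⟨_, Or.inr <| Or.inr <| Or.inl ⟨_, _, _, _, htf, rfl, h.deltaT⟩, hf⟩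

/-! ### Labelling an execution -/

/-- The labelled configuration `l` follows the configurations `C` at time `i`: processes which
are still waiting travel on shortest waiting paths, and identifiers separate exit times. -/
structure Follows (P : Protocol Q M) (b : ℕ → M) (C : ℕ → Fin n → Q) (i : ℕ)
    (l : Labelled P n) : Prop where
  tgt_eq : ∀ p, l.tgt p = nextAction P (fun j => C j p) i
  st_action : ∀ p, ¬ P.isWaiting (l.st p) → l.st p = l.tgt p
  waiting : ∀ p, P.isWaiting (l.st p) → P.isWaiting (C i p)
  path : ∀ p, P.isWaiting (l.st p) → ∃ τ, WaitPath P b i (l.tgt p) (l.st p) τ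
  exit_le : ∀ p, P.isWaiting (l.st p) → ∀ m : ℕ, i ≤ m → ¬ P.isWaiting (C m p) →
    exitTime P b i (l.tgt p) (l.st p) ≤ m
  id_iff : ∀ p r, P.isWaiting (l.st p) → P.isWaiting (l.st r) → l.tgt p = l.tgt r →
    (exitTime P b i (l.tgt p) (l.st p) = exitTime P b i (l.tgt r) (l.st r) ↔ l.id p = l.id r)

/-- An identifier for a process entering exit state `a` with exit time `τ`. -/
theorem Follows.exists_id [Finite Q] {b : ℕ → M} {C : ℕ → Fin n → Q} {i : ℕ} {l : Labelled P n}
    (h : Follows P b C i l) (a : Q) (τ : ℕ∞) :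
    ∃ k, 1 ≤ k ∧ k ≤ nW P + 1 ∧ ∀ p, P.isWaiting (l.st p) → l.tgt p = a →
      (exitTime P b i (l.tgt p) (l.st p) = τ ↔ l.id p = k) := by
  classical
  by_cases hex : ∃ p, P.isWaiting (l.st p) ∧ l.tgt p = a ∧
      exitTime P b i (l.tgt p) (l.st p) = τ
  · obtain ⟨p, hp, rfl, rfl⟩ := hex
    exact ⟨l.id p, l.id_pos p, l.id_le p, fun r hr ht => h.id_iff r p hr hp ht⟩
  · let used : Set ℕ := {k | ∃ p, P.isWaiting (l.st p) ∧ l.tgt p = a ∧ l.id p = k}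
    have hcard : used.ncard ≤ nW P := by
      have hs : ∀ k : ℕ, ∃ s, k ∈ used → s ∈ P.QW ∧
          ∃ p, P.isWaiting (l.st p) ∧ l.tgt p = a ∧ l.id p = k ∧ l.st p = s := by
        intro k
        by_cases hk : k ∈ used
        · obtain ⟨p, hp, h1, h2⟩ := hk
          exact ⟨l.st p, fun _ => ⟨hp, p, hp, h1, h2, rfl⟩⟩
        · exact ⟨P.qin, fun hc => (hk hc).elim⟩
      choose s hs using hs
      refine Set.ncard_le_ncard_of_injOn s (fun k hk => (hs k hk).1) ?_ (Set.toFinite _)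
      intro k hk k' hk' hkk
      obtain ⟨-, p, hp, h1, h2, h3⟩ := hs k hk
      obtain ⟨-, p', hp', h1', h2', h3'⟩ := hs k' hk'
      rw [← h2, ← h2']
      exact l.id_eq p p' hp (by rw [h3, h3', hkk]) (h1.trans h1'.symm)
    have hfin : used.Finite :=
      (Set.finite_range l.id).subset (by rintro k ⟨p, -, -, rfl⟩; exact ⟨p, rfl⟩)
    obtain ⟨k, hk, hku⟩ : ∃ k ∈ Set.Icc 1 (nW P + 1), k ∉ used := by
      refine Set.exists_mem_notMem_of_ncard_lt_ncard ?_ hfin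
      rw [← Finset.coe_Icc, Set.ncard_coe_finset, Nat.card_Icc]
      omega
    refine ⟨k, hk.1, hk.2, fun p hp ht => ⟨fun hc => (hex ⟨p, hp, ht, hc⟩).elim, fun hc => ?_⟩⟩
    subst hc
    exact (hku ⟨p, hp, ht, rfl⟩).elim

theorem Follows.exists_broadcast [Finite Q] (hWO : P.WaitOnly) {b : ℕ → M} {C : ℕ → Fin n → Q}
    {snd : ℕ → Fin n} (hsend : ∀ i, (C i (snd i), Act.send (b i), C (i + 1) (snd i)) ∈ P.T)
    (hlegal : ∀ i p, p ≠ snd i → Legal P (b i) (C i p) (C (i + 1) p))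
    {i : ℕ} {l : Labelled P n} (h : Follows P b C i l) :
    ∃ l' : Labelled P n, Follows P b C (i + 1) l' ∧ ∃ σ, l.Broadcast l' (snd i) (b i) σ ∧
      l.st (snd i) = C i (snd i) ∧ l'.st (snd i) = C (i + 1) (snd i) := by
  classical
  set p₀ := snd i with hp₀
  have hact : ∀ j, ¬ P.isWaiting (C j (snd j)) := fun j => not_isWaiting_of_send hWO (hsend j)
  have hl0 : ¬ P.isWaiting (l.st p₀) := fun hc => hact i (h.waiting p₀ hc)
  have hst0 : l.st p₀ = C i p₀ := by
    rw [h.st_action p₀ hl0, h.tgt_eq]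
    exact nextAction_of_action (f := fun j => C j p₀) (hact i)
  have hwl : ∀ j p, P.isWaiting (C j p) → Legal P (b j) (C j p) (C (j + 1) p) :=
    fun j p hp => hlegal j p (by rintro rfl; exact hact j hp)
  -- the policy for waiting processes
  have hpol : ∀ a s, ∃ s', ¬ P.isWaiting a → P.isWaiting s → (∃ τ, WaitPath P b i a s τ) →
      Legal P (b i) s s' ∧ (∃ τ, WaitPath P b (i + 1) a s' τ) ∧
      exitTime P b (i + 1) a s' = exitTime P b i a s ∧
      (exitTime P b i a s = (i + 1 : ℕ) → s' = a) ∧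
      (exitTime P b i a s ≠ (i + 1 : ℕ) → P.isWaiting s') := by
    intro a s
    by_cases hc : ¬ P.isWaiting a ∧ P.isWaiting s ∧ ∃ τ, WaitPath P b i a s τ
    · obtain ⟨s', hs'⟩ := exists_shortest_move hc.1 hc.2.1 hc.2.2
      exact ⟨s', fun _ _ _ => hs'⟩
    · exact ⟨s, fun h1 h2 h3 => (hc ⟨h1, h2, h3⟩).elim⟩
  choose σ hσ using hpol
  let A : Fin n → Q := fun p => nextAction P (fun j => C j p) (i + 1)
  let st' : Fin n → Q := fun p => if p = p₀ then C (i + 1) p₀ else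
    if P.isWaiting (l.st p) then σ (l.tgt p) (l.st p) else l.st p
  have hst'0 : st' p₀ = C (i + 1) p₀ := by simp [st']
  have hA : ∀ p, p ≠ p₀ → A p = l.tgt p := by
    intro p hp
    rw [h.tgt_eq]
    by_cases hw : P.isWaiting (C i p)
    · exact nextAction_succ (f := fun j => C j p) hw
    · have heq := (hlegal i p hp).eq_of_action hw
      have h1 := nextAction_of_action (f := fun j => C j p) hw
      have h2 := nextAction_of_action (f := fun j => C j p) (i := i + 1) (by simpa [heq] using hw)
      simp only [A, h1, h2, heq]
  have hne : ∀ p, P.isWaiting (l.st p) → p ≠ p₀ := by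
    rintro p hp rfl
    exact hl0 hp
  have hst'w : ∀ p, P.isWaiting (l.st p) → st' p = σ (l.tgt p) (l.st p) := by
    intro p hp
    simp [st', hne p hp, hp]
  have hst'a : ∀ p, p ≠ p₀ → ¬ P.isWaiting (l.st p) → st' p = l.st p := by
    intro p hp hw
    simp [st', hp, hw]
  have hw_of : ∀ p, p ≠ p₀ → P.isWaiting (st' p) → P.isWaiting (l.st p) := by
    intro p hp hw
    by_contra hc
    exact hc (hst'a p hp hc ▸ hw)
  have hmove : ∀ p, P.isWaiting (l.st p) → Legal P (b i) (l.st p) (st' p) ∧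
      (∃ τ, WaitPath P b (i + 1) (l.tgt p) (st' p) τ) ∧
      exitTime P b (i + 1) (l.tgt p) (st' p) = exitTime P b i (l.tgt p) (l.st p) ∧
      (exitTime P b i (l.tgt p) (l.st p) = (i + 1 : ℕ) → st' p = l.tgt p) ∧
      (exitTime P b i (l.tgt p) (l.st p) ≠ (i + 1 : ℕ) → P.isWaiting (st' p)) := by
    intro p hp
    rw [hst'w p hp]
    exact hσ _ _ (l.tgt_mem p) hp (h.path p hp)
  have hiff : ∀ p, P.isWaiting (l.st p) →
      (P.isWaiting (st' p) ↔ exitTime P b i (l.tgt p) (l.st p) ≠ (i + 1 : ℕ)) := by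
    intro p hp
    refine ⟨fun hw he => ?_, (hmove p hp).2.2.2.2⟩
    rw [(hmove p hp).2.2.2.1 he] at hw
    exact l.tgt_mem p hw
  -- the path of the sender, if it starts waiting
  obtain ⟨τ₀, hτ₀, hτ₀le⟩ := exists_waitPath_nextAction (P := P) (b := b)
    (f := fun j => C j p₀) (i := i + 1) (fun j _ hw => hwl j p₀ hw)
  obtain ⟨k, hk1, hk2, hk⟩ := h.exists_id (A p₀) (exitTime P b (i + 1) (A p₀) (C (i + 1) p₀))
  let id' : Fin n → ℕ := fun p => if p = p₀ then k else l.id p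
  have hid0 : id' p₀ = k := by simp [id']
  have hid : ∀ p, p ≠ p₀ → id' p = l.id p := fun p hp => by simp [id', hp]
  have hidiff : ∀ p p', P.isWaiting (st' p) → P.isWaiting (st' p') → A p = A p' →
      (exitTime P b (i + 1) (A p) (st' p) = exitTime P b (i + 1) (A p') (st' p') ↔
        id' p = id' p') := by
    intro p p' hp hp' hAA
    by_cases h0 : p = p₀ <;> by_cases h0' : p' = p₀
    · simp [h0, h0']
    · have hw' := hw_of p' h0' hp'
      rw [h0] at hAA ⊢
      rw [hid0, hid p' h0', eq_comm, eq_comm (a := k), hst'0, hA p' h0', (hmove p' hw').2.2.1]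
      exact hk p' hw' (by rw [hAA, hA p' h0'])
    · have hw := hw_of p h0 hp
      rw [h0'] at hAA ⊢
      rw [hid0, hid p h0, hst'0, hA p h0, (hmove p hw).2.2.1]
      exact hk p hw (by rw [← hAA, hA p h0])
    · have hw := hw_of p h0 hp
      have hw' := hw_of p' h0' hp'
      rw [hA p h0, hA p' h0'] at hAA
      rw [hid p h0, hid p' h0', hA p h0, hA p' h0', (hmove p hw).2.2.1, (hmove p' hw').2.2.1]
      exact h.id_iff p p' hw hw' hAA
  let l' : Labelled P n :=
    { st := st'
      tgt := A
      id := id'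
      tgt_mem := fun p => nextAction_mem hWO.2.1 _ _
      id_pos := fun p => by
        by_cases h0 : p = p₀
        · rw [h0, hid0]; exact hk1
        · rw [hid p h0]; exact l.id_pos p
      id_le := fun p => by
        by_cases h0 : p = p₀
        · rw [h0, hid0]; exact hk2
        · rw [hid p h0]; exact l.id_le p
      id_eq := fun p p' hp hs ha => (hidiff p p' hp (hs ▸ hp) ha).mp (by rw [hs, ha]) }
  refine ⟨l', ⟨fun p => rfl, ?_, ?_, ?_, ?_, hidiff⟩, σ, ?_, hst0, hst'0⟩
  · intro p (hw : ¬ P.isWaiting (st' p))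
    change st' p = A p
    by_cases h0 : p = p₀
    · subst h0
      rw [hst'0] at hw ⊢
      exact (nextAction_of_action (f := fun j => C j p₀) hw).symm
    · rw [hA p h0]
      by_cases hp : P.isWaiting (l.st p)
      · have := (hiff p hp).not.mp hw
        exact (hmove p hp).2.2.2.1 (not_not.mp this)
      · rw [hst'a p h0 hp, h.st_action p hp]
  · intro p (hw : P.isWaiting (st' p))
    by_cases h0 : p = p₀
    · subst h0
      rwa [hst'0] at hw
    · have hp := hw_of p h0 hw
      by_contra hc
      refine (hiff p hp).mp hw (le_antisymm (h.exit_le p hp (i + 1) (by omega) hc) ?_)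
      rw [← (hmove p hp).2.2.1]
      obtain ⟨_, _, hle, _⟩ := waitPath_exitTime (hmove p hp).2.1
      exact hle
  · intro p (hw : P.isWaiting (st' p))
    change ∃ τ, WaitPath P b (i + 1) (A p) (st' p) τ
    by_cases h0 : p = p₀
    · rw [h0, hst'0]
      exact ⟨τ₀, hτ₀⟩
    · rw [hA p h0]
      exact (hmove p (hw_of p h0 hw)).2.1
  · intro p (hw : P.isWaiting (st' p)) m hm hc
    change exitTime P b (i + 1) (A p) (st' p) ≤ m
    by_cases h0 : p = p₀
    · subst h0
      rw [hst'0]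
      exact (exitTime_le hτ₀).trans (hτ₀le m hm hc)
    · have hp := hw_of p h0 hw
      rw [hA p h0, (hmove p hp).2.2.1]
      exact h.exit_le p hp m (by omega) hc
  · refine ⟨?_, hl0, hst'a, hst'w, fun p hp => (hmove p hp).1, fun p hp => hA p (hne p hp),
      fun p hp => hid p (hne p hp), ?_, ?_, ?_⟩
    · rw [hst0]
      change (_, _, st' p₀) ∈ P.T
      rw [hst'0]
      exact hsend i
    · intro p hp hw
      exact (hmove p hp).2.2.2.1 (not_not.mp ((hiff p hp).not.mp hw))
    · intro p p' hp hp' ht hi hw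
      refine (hiff p' hp').mpr ?_
      rw [← (h.id_iff p p' hp hp' ht).mpr hi]
      exact (hiff p hp).mp hw
    · intro p hp (ht : l.tgt p = A p₀) (hi : l.id p = id' p₀) (hw : P.isWaiting (st' p₀))
      refine (hiff p hp).mpr ?_
      rw [(hk p hp ht).mpr (hi.trans hid0)]
      exact ((waitPath_exitTime ⟨τ₀, hτ₀⟩).lt (nextAction_mem hWO.2.1 _ _) (hst'0 ▸ hw)).ne'

theorem exists_vass_of_exec [Finite Q] (hWO : P.WaitOnly) {tf : Q × Act M × Q}
    {C : ℕ → Fin n → Q} (h0 : P.Initial (C 0)) (hstep : ∀ i, P.StepAny (C i) (C (i + 1)))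
    (hinf : ∀ i, ∃ j, i < j ∧ ∃ e, P.Step e tf (C j) (C (j + 1))) :
    ∃ c : ℕ → LocS Q × (Ctr P → ℕ), c 0 = (LocS.s0, 0) ∧
      (∀ i, (VPS P tf).Step (c i) (c (i + 1))) ∧
      ∀ i, ∃ j, i < j ∧ ∃ SS, (c j).1 = LocS.coS SS := by
  classical
  have hch : ∀ i, ∃ (p : Fin n) (b : M), (C i p, Act.send b, C (i + 1) p) ∈ P.T ∧
      (∀ p', p' ≠ p → Legal P b (C i p') (C (i + 1) p')) ∧
      ((∃ e, P.Step e tf (C i) (C (i + 1))) → (C i p, Act.send b, C (i + 1) p) = tf) := by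
    intro i
    have key : ∀ e t, P.Step e t (C i) (C (i + 1)) → ∃ (p : Fin n) (b : M),
        (C i p, Act.send b, C (i + 1) p) ∈ P.T ∧
        (∀ p', p' ≠ p → Legal P b (C i p') (C (i + 1) p')) ∧
        (C i p, Act.send b, C (i + 1) p) = t := by
      rintro e t ⟨_, b, _, rfl, hT, rfl, rfl, hr⟩
      exact ⟨e, b, hT, hr, rfl⟩
    by_cases hc : ∃ e, P.Step e tf (C i) (C (i + 1))
    · obtain ⟨e, he⟩ := hc
      obtain ⟨p, b, h1, h2, h3⟩ := key e tf he
      exact ⟨p, b, h1, h2, fun _ => h3⟩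
    · obtain ⟨e, t, he⟩ := hstep i
      obtain ⟨p, b, h1, h2, -⟩ := key e t he
      exact ⟨p, b, h1, h2, fun hc' => (hc hc').elim⟩
  choose snd b hsend hlegal htf using hch
  let l₀ : Labelled P n :=
    { st := C 0
      tgt := fun p => nextAction P (fun j => C j p) 0
      id := fun _ => 1
      tgt_mem := fun p => nextAction_mem hWO.2.1 _ _
      id_pos := fun _ => le_rfl
      id_le := fun _ => by omega
      id_eq := fun _ _ _ _ _ => rfl }
  have hact : ∀ p, ¬ P.isWaiting (C 0 p) := fun p => by rw [h0 p]; exact hWO.2.1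
  have hl₀ : Follows P b C 0 l₀ := ⟨fun _ => rfl,
    fun p hp => (nextAction_of_action (f := fun j => C j p) hp).symm,
    fun p hp => hp, fun p hp => (hact p hp).elim, fun p hp => (hact p hp).elim,
    fun p _ hp => (hact p hp).elim⟩
  obtain ⟨l, hl0, hl⟩ := exists_seq_of_invariant (Follows P b C)
    (R := fun i l l' => ∃ σ, l.Broadcast l' (snd i) (b i) σ ∧
      l.st (snd i) = C i (snd i) ∧ l'.st (snd i) = C (i + 1) (snd i)) hl₀
    (fun i l h => h.exists_broadcast hWO hsend hlegal)
  let xin : Ctr P := ⟨.st P.qin, hWO.2.1⟩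
  have hconf : l₀.conf = (.co ∅, countFiber fun _ : Fin n => xin) := by
    have h1 : l₀.summaries = ∅ :=
      Set.eq_empty_of_forall_notMem fun S ⟨p, hp, _⟩ => hact p hp
    have h2 : l₀.ctr = fun _ => xin := funext fun p => Subtype.ext (by
      rw [l₀.ctr_of_action (hact p)]
      exact congrArg CtrBase.st (h0 p))
    rw [Labelled.conf, h1, h2]
  let D : ℕ → LocS Q × (Ctr P → ℕ) := fun i => i.casesOn (.s0, 0) fun i => (l i).conf
  obtain ⟨c, hc0, hc1, hc2⟩ := exists_run_of_reflTransGen (r := (VPS P tf).Step)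
    (s := TaggedStep P tf) (fun x y h => h.1) D
    (by
      intro i
      cases i with
      | zero =>
        change (VPS P tf).Reach (.s0, 0) (l 0).conf
        rw [hl0, hconf]
        exact reach_initial tf xin rfl n
      | succ i =>
        obtain ⟨σ, hb, -, -⟩ := (hl i).2
        exact (hb.reach tf).1)
    (by
      intro i
      obtain ⟨j, hj, he⟩ := hinf i
      obtain ⟨σ, hb, h1, h2⟩ := (hl j).2
      obtain ⟨y, hy, hy'⟩ := (hb.reach tf).2 (by rw [h1, h2]; exact htf j he)
      exact ⟨j + 1, by omega, _, y, .refl, hy, hy'⟩)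
  refine ⟨c, hc0, hc1, fun i => ?_⟩
  obtain ⟨j, hj, -, hSS⟩ := hc2 i
  exact ⟨j + 1, by omega, hSS⟩

end BP

open BP in
/-- **Repeated coverability via the tagged VASS.** A Wait-Only protocol has an infinite
execution in which one process takes the broadcast transition `t_f` infinitely often
iff the tagged VASS `V_P^☺` has an infinite run from `(s_0, 0)` visiting tagged
locations `(SS, ☺)` infinitely often. -/
theorem repeated_coverability_iff_vass {Q M : Type} [Fintype Q] [Fintype M]
    (P : Protocol Q M) (qu : Q) (tf : Q × Act M × Q)
    (hWO : P.WaitOnly) (hqu : P.Uncoverable qu)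
    (htf : tf ∈ P.T) (hbr : ∃ q a q', tf = (q, Act.send a, q')) :
    (∃ (n : ℕ) (ρ : Exec P n), ρ.len = ⊤ ∧ ∃ e : Fin n,
       ∀ i : ℕ, ∃ j : ℕ, i < j ∧ P.Step e tf (ρ.conf j) (ρ.conf (j + 1))) ↔
    (∃ c : ℕ → LocS Q × (Ctr P → ℕ),
       c 0 = (LocS.s0, 0) ∧
       (∀ i : ℕ, (VPS P tf).Step (c i) (c (i + 1))) ∧
       ∀ i : ℕ, ∃ j : ℕ, i < j ∧ ∃ SS, (c j).1 = LocS.coS SS) := by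
  constructor
  · rintro ⟨n, ρ, hlen, e, he⟩
    refine exists_vass_of_exec hWO ρ.init
      (fun i => ρ.step i (by rw [hlen]; exact_mod_cast ENat.natCast_lt_top (i + 1)))
      fun i => ?_
    obtain ⟨j, hj, hs⟩ := he i
    exact ⟨j, hj, e, hs⟩
  · rintro ⟨c, h0, hstep, hinf⟩
    exact exists_exec_of_vass hWO h0 hstep hinf
end

section
/- Let P be a Wait-Only protocol with uncoverable state q_u and final state q_f ∈ Q_A, and let V_P be the associated modified VASS. If (s_0, 0) ⇝* (s_f, 0) in V_P, then there is a run from (s_0, 0) to (s_f, 0) in V_P in which no step uses the transition (s_f, 0, s_0). -/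
set_option maxHeartbeats 1000000

namespace BP

variable {Q M : Type}

/-- Locations of the modified VASS `V_P` (final state an action state). -/
inductive LocA (Q : Type) where
  | s0 : LocA Q
  | sf' : LocA Q
  | sf : LocA Q
  | co : Set (Summary Q) → LocA Q

/-- The modified VASS `V_P` associated to `P` and a final action state `q_f`. -/
noncomputable def VPA (P : Protocol Q M) (qf : Q) : VASS (LocA Q) (Ctr P) where
  init := .s0
  Δ := {d |
    d = (.s0, chi P (.st P.qin), .s0) ∨
    d = (.s0, 0, .co ∅) ∨
    d = (LocA.co ∅, fun y => -(chi P (.st qf) y), .sf') ∨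
    d = (.sf', chi P (.st qf), .sf) ∨
    d = (.sf, fun y => -(chi P (.st qf) y), .sf) ∨
    d = (.sf, 0, .s0) ∨
    (∃ t SS δ SS', d = (.co SS, δ, .co SS') ∧ DeltaT P t SS δ SS') ∨
    (∃ SS δ, d = (.co SS, δ, .co SS) ∧ DeltaE P SS δ)}

end BP

namespace VASS

variable {L X : Type}

/-- One VASS step through a transition different from `d`. -/
def StepAvoiding (V : VASS L X) (d : L × (X → ℤ) × L) (c c' : L × (X → ℕ)) : Prop :=
  ∃ δ, (c.1, δ, c'.1) ∈ V.Δ ∧ (∀ x, (c'.2 x : ℤ) = (c.2 x : ℤ) + δ x) ∧ (c.1, δ, c'.1) ≠ d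

theorem StepAvoiding.add {V : VASS L X} {d : L × (X → ℤ) × L} {c c' : L × (X → ℕ)}
    (h : V.StepAvoiding d c c') (w : X → ℕ) :
    V.StepAvoiding d (c.1, c.2 + w) (c'.1, c'.2 + w) := by
  obtain ⟨δ, hδ, hx, hne⟩ := h
  refine ⟨δ, hδ, fun x => ?_, hne⟩
  have := hx x
  simp only [Pi.add_apply, Nat.cast_add]
  linarith

theorem reachAvoiding_add {V : VASS L X} {d : L × (X → ℤ) × L} {c c' : L × (X → ℕ)}
    (h : Relation.ReflTransGen (V.StepAvoiding d) c c') (w : X → ℕ) :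
    Relation.ReflTransGen (V.StepAvoiding d) (c.1, c.2 + w) (c'.1, c'.2 + w) :=
  h.lift (fun c => (c.1, c.2 + w)) fun _ _ h => h.add w

end VASS

theorem Relation.ReflTransGen.exists_seq {α : Type*} {r : α → α → Prop} {a b : α}
    (h : Relation.ReflTransGen r a b) :
    ∃ (N : ℕ) (c : ℕ → α), c 0 = a ∧ c N = b ∧ ∀ i < N, r (c i) (c (i + 1)) := by
  induction h using Relation.ReflTransGen.head_induction_on with
  | refl => exact ⟨0, fun _ => b, rfl, rfl, fun _ hi => absurd hi (Nat.not_lt_zero _)⟩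
  | @head a a' h _ ih =>
    obtain ⟨N, c, h0, hN, hc⟩ := ih
    refine ⟨N + 1, fun i => Nat.casesOn i a c, rfl, hN, fun i hi => ?_⟩
    cases i with
    | zero => simpa [h0] using h
    | succ i => exact hc i (by omega)

namespace BP

variable {Q M : Type} {P : Protocol Q M} {qf : Q}

open Classical in
/-- The valuation with a single token, placed on `q`. -/
noncomputable def token (P : Protocol Q M) (q : Q) : Ctr P → ℕ :=
  fun y => if y.val = .st q then 1 else 0

theorem cast_token (q : Q) (y : Ctr P) : (token P q y : ℤ) = chi P (.st q) y := by
  simp [token, chi]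

/-- Steps of the modified VASS that do not use the reset transition. -/
abbrev ResetFreeStep (P : Protocol Q M) (qf : Q) :=
  (VPA P qf).StepAvoiding (LocA.sf, 0, LocA.s0)

abbrev ResetFreeReach (P : Protocol Q M) (qf : Q) :=
  Relation.ReflTransGen (ResetFreeStep P qf)

theorem resetFreeStep_s0_s0 (v : Ctr P → ℕ) :
    ResetFreeStep P qf (.s0, v) (.s0, v + token P P.qin) :=
  ⟨chi P (.st P.qin), by simp [VPA], fun x => by simp [cast_token], by simp⟩

theorem resetFreeStep_s0_co (v : Ctr P → ℕ) :
    ResetFreeStep P qf (.s0, v) (.co ∅, v) :=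
  ⟨0, by simp [VPA], fun x => by simp, by simp⟩

theorem resetFreeStep_co_sf' (v : Ctr P → ℕ) :
    ResetFreeStep P qf (.co ∅, v + token P qf) (.sf', v) :=
  ⟨fun y => -(chi P (.st qf) y), by simp [VPA], fun x => by simp [cast_token], by simp⟩

theorem resetFreeStep_sf'_sf (v : Ctr P → ℕ) :
    ResetFreeStep P qf (.sf', v) (.sf, v + token P qf) :=
  ⟨chi P (.st qf), by simp [VPA], fun x => by simp [cast_token], by simp⟩

theorem resetFreeStep_sf_sf (v : Ctr P → ℕ) :
    ResetFreeStep P qf (.sf, v + token P qf) (.sf, v) :=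
  ⟨fun y => -(chi P (.st qf) y), by simp [VPA], fun x => by simp [cast_token], by simp⟩

theorem resetFreeReach_sf_zero (m : ℕ) :
    ResetFreeReach P qf (.sf, m • token P qf) (.sf, 0) := by
  induction m with
  | zero => simpa using Relation.ReflTransGen.refl
  | succ m ih => exact .head (by rw [succ_nsmul]; exact resetFreeStep_sf_sf _) ih

/-- The reset-free run simulating a run to `c`: it stays among the coherent sets and keeps as
many additional tokens on `qf` as the simulated run has removed. -/
def Simulated (P : Protocol Q M) (qf : Q) : LocA Q × (Ctr P → ℕ) → Prop
  | (.s0, v) => ∃ m : ℕ, ResetFreeReach P qf (.s0, 0) (.co ∅, v + m • token P qf)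
  | (.co SS, v) => ∃ m : ℕ, ResetFreeReach P qf (.s0, 0) (.co SS, v + m • token P qf)
  | (.sf', v) => ∃ m : ℕ, ResetFreeReach P qf (.s0, 0) (.co ∅, v + (m + 1) • token P qf)
  | (.sf, v) => ∃ m : ℕ, ResetFreeReach P qf (.s0, 0) (.co ∅, v + m • token P qf) ∧
      ∃ y : Ctr P, y.val = .st qf ∧ 1 ≤ v y + m

theorem Simulated.step (hqf : qf ∈ P.QA) {c c' : LocA Q × (Ctr P → ℕ)}
    (hc : Simulated P qf c) (h : (VPA P qf).Step c c') : Simulated P qf c' := by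
  obtain ⟨l, v⟩ := c
  obtain ⟨l', v'⟩ := c'
  obtain ⟨δ, hδ, hv⟩ := h
  have hδ' := hδ
  simp only [VPA, Set.mem_ofPred_eq, Prod.mk.injEq] at hδ'
  have co_step : ∀ SS SS', l = .co SS → l' = .co SS' → Simulated P qf (l', v') := by
    rintro SS SS' rfl rfl
    obtain ⟨m, hm⟩ := hc
    exact ⟨m, hm.tail (VASS.StepAvoiding.add ⟨δ, hδ, hv, by simp⟩ _)⟩
  rcases hδ' with ⟨rfl, rfl, rfl⟩ | ⟨rfl, rfl, rfl⟩ | ⟨rfl, rfl, rfl⟩ | ⟨rfl, rfl, rfl⟩ |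
    ⟨rfl, rfl, rfl⟩ | ⟨rfl, rfl, rfl⟩ | ⟨t, SS, δ', SS', ⟨hl, -, hl'⟩, -⟩ |
    ⟨SS, δ', ⟨hl, -, hl'⟩, -⟩
  · obtain ⟨m, hm⟩ := hc
    have : v' = v + token P P.qin := by
      funext x
      have := hv x
      simp only [← cast_token] at this
      exact_mod_cast this
    subst this
    refine ⟨m, .head (resetFreeStep_s0_s0 0) ?_⟩
    rw [add_right_comm]
    exact VASS.reachAvoiding_add hm (token P P.qin)
  · obtain rfl : v' = v := by
      funext x
      simpa using hv x
    obtain ⟨m, hm⟩ := hc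
    exact ⟨m, hm⟩
  · obtain ⟨m, hm⟩ := hc
    have : v = v' + token P qf := by
      funext x
      have := hv x
      simp only [← cast_token] at this
      simp only [Pi.add_apply]
      omega
    subst this
    exact ⟨m, by rwa [succ_nsmul', ← add_assoc]⟩
  · obtain ⟨m, hm⟩ := hc
    have : v' = v + token P qf := by
      funext x
      have := hv x
      simp only [← cast_token] at this
      exact_mod_cast this
    subst this
    refine ⟨m, by rwa [add_assoc, ← succ_nsmul'], ⟨.st qf, hqf⟩, rfl, ?_⟩
    simp [token]
    omega
  · obtain ⟨m, hm, y, hy, hym⟩ := hc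
    have : v = v' + token P qf := by
      funext x
      have := hv x
      simp only [← cast_token] at this
      simp only [Pi.add_apply]
      omega
    subst this
    refine ⟨m + 1, by rwa [succ_nsmul', ← add_assoc], y, hy, by omega⟩
  · obtain ⟨m, hm, -⟩ := hc
    obtain rfl : v' = v := by
      funext x
      simpa using hv x
    exact ⟨m, hm⟩
  · exact co_step _ _ hl hl'
  · exact co_step _ _ hl hl'

theorem simulated_of_reach (hqf : qf ∈ P.QA) {c : LocA Q × (Ctr P → ℕ)}
    (h : (VPA P qf).Reach (.s0, 0) c) : Simulated P qf c := by
  induction h with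
  | refl => exact ⟨0, by simpa using .single (resetFreeStep_s0_co 0)⟩
  | tail _ h ih => exact ih.step hqf h

theorem resetFreeReach_of_reach (hqf : qf ∈ P.QA)
    (h : (VPA P qf).Reach (.s0, 0) (.sf, 0)) : ResetFreeReach P qf (.s0, 0) (.sf, 0) := by
  obtain ⟨m, hm, y, -, hy⟩ := simulated_of_reach hqf h
  obtain ⟨m, rfl⟩ : ∃ k, m = k + 1 := ⟨m - 1, by simp at hy; omega⟩
  rw [zero_add] at hm
  refine hm.trans (.head (b := (.sf', m • token P qf)) ?_ (.head (resetFreeStep_sf'_sf _) ?_))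
  · rw [succ_nsmul]
    exact resetFreeStep_co_sf' _
  · rw [← succ_nsmul]
    exact resetFreeReach_sf_zero _

end BP

open BP in
/-- **Avoiding the reset transition.** If `(s_0, 0) ⇝* (s_f, 0)` in the modified VASS
`V_P`, then there is a run from `(s_0, 0)` to `(s_f, 0)` in which no step uses the
transition `(s_f, 0, s_0)`. -/
theorem reach_avoiding_reset {Q M : Type} [Fintype Q] [Fintype M]
    (P : Protocol Q M) (qu qf : Q)
    (hWO : P.WaitOnly) (hqu : P.Uncoverable qu) (hqf : qf ∈ P.QA)
    (hreach : (VPA P qf).Reach (LocA.s0, 0) (LocA.sf, 0)) :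
    ∃ (N : ℕ) (c : ℕ → LocA Q × (Ctr P → ℕ)),
      c 0 = (LocA.s0, 0) ∧ c N = (LocA.sf, 0) ∧
      ∀ i < N, ∃ δ : Ctr P → ℤ,
        ((c i).1, δ, (c (i + 1)).1) ∈ (VPA P qf).Δ ∧
        (∀ x, ((c (i + 1)).2 x : ℤ) = ((c i).2 x : ℤ) + δ x) ∧
        ((c i).1, δ, (c (i + 1)).1) ≠ (LocA.sf, 0, LocA.s0) := by
  exact (resetFreeReach_of_reach hqf hreach).exists_seq
end
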